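/- Fix m ∈ ℕ, dimensions n, n₁, …, n_m with n_j ≤ n, and exponents p = (p₁, …, p_m) with each p_j ∈ [0,1]. Then the Brascamp–Lieb constant BL(·, p), viewed as a map from the set of m-tuples L = (L₁, …, L_m) of surjective linear maps L_j : ℝⁿ → ℝ^{n_j} (an open subset of the finite-dimensional normed space ∏_j Hom(ℝⁿ, ℝ^{n_j})) into the extended nonnegative reals [0,∞] equipped with the order topology, is continuous. In particular, if BL(L⁰, p) = ∞ and Lᵏ → L⁰, then BL(Lᵏ, p) → ∞. -/

import Mathlib

open MeasureTheory ENNReal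

/-- The Brascamp–Lieb constant `BL(L, p)` associated to an `m`-tuple of linear maps
`L j : ℝⁿ → ℝ^{n_j}` and exponents `p j`: the supremum, over all measurable
`f j : ℝ^{n_j} → [0,∞]` with positive finite Lebesgue integral, of the ratio
`(∫ ∏ (f j ∘ L j)^(p j)) / ∏ (∫ f j)^(p j)`. -/
noncomputable def brascampLieb {m n : ℕ} {ni : Fin m → ℕ}
    (L : ∀ j, (Fin n → ℝ) →L[ℝ] (Fin (ni j) → ℝ)) (p : Fin m → ℝ) : ℝ≥0∞ :=
  ⨆ (f : ∀ j, (Fin (ni j) → ℝ) → ℝ≥0∞) (_ : ∀ j, Measurable (f j))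
    (_ : ∀ j, 0 < ∫⁻ y, f j y) (_ : ∀ j, ∫⁻ y, f j y < ⊤),
    (∫⁻ x : Fin n → ℝ, ∏ j, (f j (L j x)) ^ (p j)) / ∏ j, (∫⁻ y, f j y) ^ (p j)

namespace BLC

/-! ### Softmax calculus -/

section Softmax
variable {S : Type*} [Fintype S]

lemma wsum_pos {c : S → ℝ} (hc : ∀ s, 0 ≤ c s) (hc' : ∃ s, 0 < c s) (E : S → ℝ) :
    0 < ∑ s, c s * Real.exp (E s) := by
  obtain ⟨s, hs⟩ := hc'
  exact Finset.sum_pos' (fun s _ => mul_nonneg (hc s) (Real.exp_pos _).le)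
    ⟨s, Finset.mem_univ _, mul_pos hs (Real.exp_pos _)⟩

lemma hasDerivAt_wsum (c : S → ℝ) (E : S → ℝ → ℝ) (E' : S → ℝ) (Q : S → ℝ → ℝ) (Q' : S → ℝ)
    (t : ℝ) (h : ∀ s, HasDerivAt (E s) (E' s) t) (hQ : ∀ s, HasDerivAt (Q s) (Q' s) t) :
    HasDerivAt (fun t => ∑ s, c s * Real.exp (E s t) * Q s t)
      (∑ s, c s * Real.exp (E s t) * (E' s * Q s t + Q' s)) t := by
  apply HasDerivAt.fun_sum
  intro s _
  have := (((h s).exp).const_mul (c s)).mul (hQ s)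
  refine HasDerivAt.congr_deriv (this) ?_
  ring

lemma hasDerivAt_log_wsum {c : S → ℝ} (hc : ∀ s, 0 ≤ c s) (hc' : ∃ s, 0 < c s)
    (E : S → ℝ → ℝ) (E' : S → ℝ) (t : ℝ) (h : ∀ s, HasDerivAt (E s) (E' s) t) :
    HasDerivAt (fun t => Real.log (∑ s, c s * Real.exp (E s t)))
      (∑ s, (c s * Real.exp (E s t) / ∑ s, c s * Real.exp (E s t)) * E' s) t := by
  have h1 := hasDerivAt_wsum c E E' (fun _ _ => 1) (fun _ => 0) t h
    (fun s => hasDerivAt_const t 1)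
  simp only [mul_one, add_zero] at h1
  refine HasDerivAt.congr_deriv (h1.log (wsum_pos hc hc' _).ne') ?_
  rw [Finset.sum_div]
  exact Finset.sum_congr rfl fun s _ => by ring

lemma hasDerivAt_avg {c : S → ℝ} (hc : ∀ s, 0 ≤ c s) (hc' : ∃ s, 0 < c s)
    (E : S → ℝ → ℝ) (E' : S → ℝ) (Q : S → ℝ → ℝ) (Q' : S → ℝ)
    (t : ℝ) (h : ∀ s, HasDerivAt (E s) (E' s) t) (hQ : ∀ s, HasDerivAt (Q s) (Q' s) t) :
    HasDerivAt (fun t => ∑ s, (c s * Real.exp (E s t) / ∑ s, c s * Real.exp (E s t)) * Q s t)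
      ((∑ s, (c s * Real.exp (E s t) / ∑ s, c s * Real.exp (E s t)) * (E' s * Q s t + Q' s))
       - (∑ s, (c s * Real.exp (E s t) / ∑ s, c s * Real.exp (E s t)) * Q s t)
        * (∑ s, (c s * Real.exp (E s t) / ∑ s, c s * Real.exp (E s t)) * E' s)) t := by
  have h1 := hasDerivAt_wsum c E E' (fun _ _ => 1) (fun _ => 0) t h
    (fun s => hasDerivAt_const t 1)
  simp only [mul_one, add_zero] at h1
  have h2 := hasDerivAt_wsum c E E' Q Q' t h hQ
  have h0 := wsum_pos hc hc' (fun s => E s t)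
  have h3 := h2.div h1 h0.ne'
  have e : ∀ R : S → ℝ, (∑ s, (c s * Real.exp (E s t) / ∑ s, c s * Real.exp (E s t)) * R s)
      = (∑ s, c s * Real.exp (E s t) * R s) / ∑ s, c s * Real.exp (E s t) := by
    intro R
    rw [Finset.sum_div]
    exact Finset.sum_congr rfl fun s _ => by ring
  have e' : (fun t => ∑ s, (c s * Real.exp (E s t) / ∑ s, c s * Real.exp (E s t)) * Q s t)
      = (fun t => (∑ s, c s * Real.exp (E s t) * Q s t) / ∑ s, c s * Real.exp (E s t)) := by
    funext t
    rw [Finset.sum_div]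
    exact Finset.sum_congr rfl fun s _ => by ring
  rw [e', e, e, e]
  refine HasDerivAt.congr_deriv (h3) ?_
  field_simp

end Softmax

/-- Normalised data for the monotonicity argument. -/
structure Dat (ι ν : Type) (κ σ : ι → Type) [Fintype ι] [Fintype ν] [DecidableEq ν]
    [∀ j, Fintype (κ j)] [∀ j, Fintype (σ j)] where
  p : ι → ℝ
  hp : ∀ j, 0 ≤ p j
  l : ∀ j, κ j → ν → ℝ
  th : ∀ j, κ j → ℝ
  th0 : ∀ j i, 0 < th j i
  th1 : ∀ j i, th j i ≤ 1
  c : ∀ j, σ j → ℝ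
  c0 : ∀ j s, 0 ≤ c j s
  c1 : ∀ j, ∃ s, 0 < c j s
  a : ∀ j, σ j → κ j → ℝ
  frame : ∀ k k', ∑ j, p j * ∑ i, l j i k * l j i k' = if k = k' then 1 else 0
  hN : ∀ j, 0 < p j → ∀ ξ : κ j → ℝ, ∑ k, (∑ i, ξ i * l j i k) ^ 2 ≤ ∑ i, ξ i ^ 2
  hE : ∀ j, 0 < p j → ∀ i, th j i = 1 ∨ ∑ k, l j i k ^ 2 = 1

namespace Dat

variable {ι ν : Type} {κ σ : ι → Type} [Fintype ι] [Fintype ν] [DecidableEq ν]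
    [∀ j, Fintype (κ j)] [∀ j, Fintype (σ j)] (D : Dat ι ν κ σ)

noncomputable def Y (j : ι) (i : κ j) (x : ν → ℝ) : ℝ := ∑ k, D.l j i k * x k
noncomputable def tau (j : ι) (i : κ j) (r : ℝ) : ℝ := (1 - r ^ 2 * (1 - D.th j i))⁻¹
noncomputable def q (j : ι) (s : σ j) (i : κ j) (r : ℝ) (x : ν → ℝ) : ℝ :=
  -(2 * Real.pi) * D.tau j i r * (D.Y j i x - r * D.a j s i)
noncomputable def E (j : ι) (s : σ j) (r : ℝ) (x : ν → ℝ) : ℝ :=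
  ∑ i, ((1 / 2) * Real.log (D.tau j i r)
    - Real.pi * D.tau j i r * (D.Y j i x - r * D.a j s i) ^ 2)
noncomputable def u (j : ι) (r : ℝ) (x : ν → ℝ) : ℝ :=
  ∑ s, D.c j s * Real.exp (D.E j s r x)
noncomputable def w (j : ι) (s : σ j) (r : ℝ) (x : ν → ℝ) : ℝ :=
  D.c j s * Real.exp (D.E j s r x) / D.u j r x
noncomputable def qb (j : ι) (i : κ j) (r : ℝ) (x : ν → ℝ) : ℝ :=
  ∑ s, D.w j s r x * D.q j s i r x
noncomputable def Phi (r : ℝ) (x : ν → ℝ) : ℝ := ∑ j, D.p j * Real.log (D.u j r x)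
noncomputable def rho (r : ℝ) (x : ν → ℝ) : ℝ := Real.exp (D.Phi r x)
/-- derivative in `r` of `E` -/
noncomputable def Er (j : ι) (s : σ j) (r : ℝ) (x : ν → ℝ) : ℝ :=
  ∑ i, (r * (1 - D.th j i) * D.tau j i r
    - Real.pi * (2 * r * (1 - D.th j i) * D.tau j i r ^ 2) * (D.Y j i x - r * D.a j s i) ^ 2
    + 2 * Real.pi * D.tau j i r * D.a j s i * (D.Y j i x - r * D.a j s i))
noncomputable def Phir (r : ℝ) (x : ν → ℝ) : ℝ := ∑ j, D.p j * ∑ s, D.w j s r x * D.Er j s r x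
/-- `k`-th partial derivative of `Φ` -/
noncomputable def G (k : ν) (r : ℝ) (x : ν → ℝ) : ℝ :=
  ∑ j, D.p j * ∑ i, D.l j i k * D.qb j i r x
noncomputable def qbk (j : ι) (i : κ j) (k : ν) (r : ℝ) (x : ν → ℝ) : ℝ :=
  (∑ s, D.w j s r x * ((∑ i', D.l j i' k * D.q j s i' r x) * D.q j s i r x
      + -(2 * Real.pi) * D.tau j i r * D.l j i k))
    - D.qb j i r x * ∑ s, D.w j s r x * ∑ i', D.l j i' k * D.q j s i' r x
noncomputable def Gk (k : ν) (r : ℝ) (x : ν → ℝ) : ℝ :=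
  ∑ j, D.p j * ∑ i, D.l j i k * D.qbk j i k r x

lemma u_pos (j : ι) (r : ℝ) (x : ν → ℝ) : 0 < D.u j r x := wsum_pos (D.c0 j) (D.c1 j) _

lemma w_nonneg (j : ι) (s : σ j) (r : ℝ) (x : ν → ℝ) : 0 ≤ D.w j s r x :=
  div_nonneg (mul_nonneg (D.c0 j s) (Real.exp_pos _).le) (D.u_pos j r x).le

lemma w_sum (j : ι) (r : ℝ) (x : ν → ℝ) : ∑ s, D.w j s r x = 1 := by
  unfold w
  rw [← Finset.sum_div]
  exact div_self (D.u_pos j r x).ne'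

lemma den_pos (j : ι) (i : κ j) {r : ℝ} (hr : r ∈ Set.Icc (0:ℝ) 1) :
    0 < 1 - r ^ 2 * (1 - D.th j i) := by
  have h1 := D.th0 j i
  have h2 := D.th1 j i
  have : r ^ 2 ≤ 1 := by nlinarith [hr.1, hr.2]
  nlinarith [sq_nonneg r]

lemma tau_pos (j : ι) (i : κ j) {r : ℝ} (hr : r ∈ Set.Icc (0:ℝ) 1) : 0 < D.tau j i r :=
  inv_pos.2 (D.den_pos j i hr)

lemma one_le_tau (j : ι) (i : κ j) {r : ℝ} (hr : r ∈ Set.Icc (0:ℝ) 1) : 1 ≤ D.tau j i r := by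
  unfold tau
  rw [one_le_inv₀ (D.den_pos j i hr)]
  nlinarith [sq_nonneg r, D.th1 j i]

lemma tau_le (j : ι) (i : κ j) {r : ℝ} (hr : r ∈ Set.Icc (0:ℝ) 1) :
    D.tau j i r ≤ (D.th j i)⁻¹ := by
  unfold tau
  apply inv_anti₀ (D.th0 j i)
  have : r ^ 2 ≤ 1 := by nlinarith [hr.1, hr.2]
  nlinarith [sq_nonneg r, D.th1 j i]

lemma tau_eq (j : ι) (i : κ j) {r : ℝ} (hr : r ∈ Set.Icc (0:ℝ) 1) :
    r ^ 2 * (1 - D.th j i) * D.tau j i r = D.tau j i r - 1 := by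
  have := (D.den_pos j i hr).ne'
  unfold tau
  field_simp
  ring

lemma hasDerivAt_tau (j : ι) (i : κ j) {r : ℝ} (hr : r ∈ Set.Icc (0:ℝ) 1) :
    HasDerivAt (D.tau j i) (2 * r * (1 - D.th j i) * D.tau j i r ^ 2) r := by
  have h := (D.den_pos j i hr).ne'
  have h1 : HasDerivAt (fun r : ℝ => 1 - r ^ 2 * (1 - D.th j i)) (-(2 * r * (1 - D.th j i))) r := by
    have := ((hasDerivAt_pow 2 r).mul_const (1 - D.th j i)).const_sub 1
    refine HasDerivAt.congr_deriv (this) ?_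
    norm_num
  have := h1.inv h
  refine HasDerivAt.congr_deriv (this) ?_
  unfold tau
  field_simp

lemma hasDerivAt_E (j : ι) (s : σ j) {r : ℝ} (hr : r ∈ Set.Icc (0:ℝ) 1) (x : ν → ℝ) :
    HasDerivAt (fun r => D.E j s r x) (D.Er j s r x) r := by
  unfold E Er
  apply HasDerivAt.fun_sum
  intro i _
  have h1 := D.hasDerivAt_tau j i hr
  have h2 := (h1.log (D.tau_pos j i hr).ne').const_mul (1 / 2)
  have h3 : HasDerivAt (fun r => (D.Y j i x - r * D.a j s i)) (-(D.a j s i)) r := by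
    simpa using ((hasDerivAt_id r).mul_const (D.a j s i)).const_sub (D.Y j i x)
  have h4 := (h1.const_mul Real.pi).mul (h3.pow 2)
  have h5 := h2.sub h4
  refine HasDerivAt.congr_deriv (h5) ?_
  have := (D.tau_pos j i hr).ne'
  simp only [Pi.pow_apply]
  field_simp
  push_cast
  ring

lemma hasDerivAt_Phi {r : ℝ} (hr : r ∈ Set.Icc (0:ℝ) 1) (x : ν → ℝ) :
    HasDerivAt (fun r => D.Phi r x) (D.Phir r x) r := by
  unfold Phi Phir
  apply HasDerivAt.fun_sum
  intro j _
  apply HasDerivAt.const_mul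
  exact hasDerivAt_log_wsum (D.c0 j) (D.c1 j) (fun s r => D.E j s r x) (fun s => D.Er j s r x) r
    (fun s => D.hasDerivAt_E j s hr x)

lemma hasDerivAt_Y (j : ι) (i : κ j) (k : ν) (x : ν → ℝ) (t : ℝ) :
    HasDerivAt (fun t : ℝ => D.Y j i (x + t • (Pi.single k 1 : ν → ℝ))) (D.l j i k) t := by
  have : (fun t : ℝ => D.Y j i (x + t • (Pi.single k 1 : ν → ℝ))) = fun t => D.Y j i x + t * D.l j i k := by
    funext t
    unfold Y
    simp [mul_add, Finset.sum_add_distrib, Pi.single_apply, mul_comm t]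
  rw [this]
  simpa using ((hasDerivAt_id t).mul_const (D.l j i k)).const_add (D.Y j i x)

lemma hasDerivAt_Ex (j : ι) (s : σ j) (k : ν) (r : ℝ) (x : ν → ℝ) :
    HasDerivAt (fun t : ℝ => D.E j s r (x + t • (Pi.single k 1 : ν → ℝ)))
      (∑ i', D.l j i' k * D.q j s i' r x) 0 := by
  unfold E q
  apply HasDerivAt.fun_sum
  intro i _
  have h := (((D.hasDerivAt_Y j i k x 0).sub_const (r * D.a j s i)).pow 2).const_mul
    (Real.pi * D.tau j i r)
  have h2 := h.const_sub ((1 / 2) * Real.log (D.tau j i r))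
  refine HasDerivAt.congr_deriv (h2) ?_
  simp only [zero_smul, add_zero]
  push_cast
  ring

lemma hasDerivAt_qx (j : ι) (s : σ j) (i : κ j) (k : ν) (r : ℝ) (x : ν → ℝ) :
    HasDerivAt (fun t : ℝ => D.q j s i r (x + t • (Pi.single k 1 : ν → ℝ)))
      (-(2 * Real.pi) * D.tau j i r * D.l j i k) 0 := by
  unfold q
  exact ((D.hasDerivAt_Y j i k x 0).sub_const (r * D.a j s i)).const_mul _

lemma hasDerivAt_Phix (k : ν) (r : ℝ) (x : ν → ℝ) :
    HasDerivAt (fun t : ℝ => D.Phi r (x + t • (Pi.single k 1 : ν → ℝ))) (D.G k r x) 0 := by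
  unfold Phi G
  apply HasDerivAt.fun_sum
  intro j _
  apply HasDerivAt.const_mul
  have := hasDerivAt_log_wsum (D.c0 j) (D.c1 j) (fun s t => D.E j s r (x + t • (Pi.single k 1 : ν → ℝ))) _ 0
    (fun s => D.hasDerivAt_Ex j s k r x)
  simp only [zero_smul, add_zero] at this
  refine HasDerivAt.congr_deriv (this) ?_
  unfold qb w u
  simp only [Finset.mul_sum]
  rw [Finset.sum_comm]
  exact Finset.sum_congr rfl fun s _ => Finset.sum_congr rfl fun i _ => by ring

lemma hasDerivAt_qbx (j : ι) (i : κ j) (k : ν) (r : ℝ) (x : ν → ℝ) :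
    HasDerivAt (fun t : ℝ => D.qb j i r (x + t • (Pi.single k 1 : ν → ℝ))) (D.qbk j i k r x) 0 := by
  have := hasDerivAt_avg (D.c0 j) (D.c1 j) (fun s t => D.E j s r (x + t • (Pi.single k 1 : ν → ℝ))) _
    (fun s t => D.q j s i r (x + t • (Pi.single k 1 : ν → ℝ))) _ 0
    (fun s => D.hasDerivAt_Ex j s k r x) (fun s => D.hasDerivAt_qx j s i k r x)
  simp only [zero_smul, add_zero] at this
  exact this

lemma hasDerivAt_Gx (k : ν) (r : ℝ) (x : ν → ℝ) :
    HasDerivAt (fun t : ℝ => D.G k r (x + t • (Pi.single k 1 : ν → ℝ))) (D.Gk k r x) 0 := by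
  unfold G Gk
  apply HasDerivAt.fun_sum
  intro j _
  apply HasDerivAt.const_mul
  apply HasDerivAt.fun_sum
  intro i _
  apply HasDerivAt.const_mul
  exact D.hasDerivAt_qbx j i k r x

/-- the vector field `ρ Z` -/
noncomputable def V (k : ν) (r : ℝ) (x : ν → ℝ) : ℝ :=
  D.rho r x * (x k + (2 * Real.pi)⁻¹ * D.G k r x)
noncomputable def Vk (k : ν) (r : ℝ) (x : ν → ℝ) : ℝ :=
  D.rho r x * (D.G k r x * (x k + (2 * Real.pi)⁻¹ * D.G k r x)
    + (1 + (2 * Real.pi)⁻¹ * D.Gk k r x))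

lemma hasLineDerivAt_V (k : ν) (r : ℝ) (x : ν → ℝ) :
    HasLineDerivAt ℝ (D.V k r) (D.Vk k r x) x (Pi.single k 1) := by
  unfold HasLineDerivAt V Vk rho
  have h1 := (D.hasDerivAt_Phix k r x).exp
  have h2 : HasDerivAt (fun t : ℝ => (x + t • (Pi.single k (1:ℝ) : ν → ℝ)) k) 1 0 := by
    simpa using (hasDerivAt_id (0:ℝ)).const_add (x k)
  have h3 := h1.mul (h2.add ((D.hasDerivAt_Gx k r x).const_mul (2 * Real.pi)⁻¹))
  refine HasDerivAt.congr_deriv (h3) ?_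
  simp
  ring

end Dat
end BLC

namespace BLC

lemma var_eq {S : Type*} [Fintype S] (w z : S → ℝ) (hw : ∑ s, w s = 1) :
    ∑ s, w s * (z s - ∑ s, w s * z s) ^ 2 = ∑ s, w s * z s ^ 2 - (∑ s, w s * z s) ^ 2 := by
  set m := ∑ s, w s * z s with hm
  have : ∀ s, w s * (z s - m) ^ 2 = w s * z s ^ 2 - 2 * m * (w s * z s) + m ^ 2 * w s := by
    intro s; ring
  simp only [this, Finset.sum_add_distrib, Finset.sum_sub_distrib, ← Finset.mul_sum, hw, ← hm]
  ring

namespace Dat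
variable {ι ν : Type} {κ σ : ι → Type} [Fintype ι] [Fintype ν] [DecidableEq ν]
    [∀ j, Fintype (κ j)] [∀ j, Fintype (σ j)] (D : Dat ι ν κ σ)

lemma frame_sq (x : ν → ℝ) : ∑ j, D.p j * ∑ i, (D.Y j i x) ^ 2 = ∑ k, x k ^ 2 := by
  have h : ∀ j i, (D.Y j i x) ^ 2 = ∑ k, ∑ k', x k * x k' * (D.l j i k * D.l j i k') := by
    intro j i
    unfold Y
    rw [sq, Finset.sum_mul_sum]
    exact Finset.sum_congr rfl fun k _ => Finset.sum_congr rfl fun k' _ => by ring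
  have h2 : ∑ j, D.p j * ∑ i, (D.Y j i x) ^ 2
      = ∑ k, ∑ k', x k * x k' * ∑ j, D.p j * ∑ i, D.l j i k * D.l j i k' := by
    simp only [h, Finset.mul_sum]
    calc _ = ∑ j, ∑ k, ∑ i, ∑ k', D.p j * (x k * x k' * (D.l j i k * D.l j i k')) :=
          Finset.sum_congr rfl fun j _ => Finset.sum_comm
      _ = ∑ k, ∑ j, ∑ i, ∑ k', D.p j * (x k * x k' * (D.l j i k * D.l j i k')) := Finset.sum_comm
      _ = ∑ k, ∑ j, ∑ k', ∑ i, D.p j * (x k * x k' * (D.l j i k * D.l j i k')) :=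
          Finset.sum_congr rfl fun j _ => Finset.sum_congr rfl fun j _ => Finset.sum_comm
      _ = ∑ k, ∑ k', ∑ j, ∑ i, D.p j * (x k * x k' * (D.l j i k * D.l j i k')) :=
          Finset.sum_congr rfl fun j _ => Finset.sum_comm
      _ = _ := by
          refine Finset.sum_congr rfl fun k _ => Finset.sum_congr rfl fun k' _ =>
            Finset.sum_congr rfl fun j _ => Finset.sum_congr rfl fun i _ => by ring
  rw [h2]
  simp [D.frame, sq]

lemma sum_sq_le (v : ∀ j, κ j → ℝ) :
    ∑ k, (∑ j, D.p j * ∑ i, D.l j i k * v j i) ^ 2 ≤ ∑ j, D.p j * ∑ i, v j i ^ 2 := by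
  set z : ν → ℝ := fun k => ∑ j, D.p j * ∑ i, D.l j i k * v j i with hz
  have h1 : ∑ k, z k ^ 2 = ∑ j, D.p j * ∑ i, v j i * D.Y j i z := by
    have : ∀ k, z k ^ 2 = ∑ j, D.p j * ∑ i, v j i * (D.l j i k * z k) := by
      intro k
      rw [sq]
      conv_lhs => lhs; rw [hz]
      simp only [Finset.sum_mul, Finset.mul_sum]
      exact Finset.sum_congr rfl fun k _ => Finset.sum_congr rfl fun k' _ => by ring
    simp only [this, Y]
    rw [Finset.sum_comm]
    refine Finset.sum_congr rfl fun j _ => ?_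
    rw [← Finset.mul_sum, Finset.sum_comm]
    simp only [Finset.mul_sum]
  have h2 : ∑ j, D.p j * ∑ i, v j i * D.Y j i z
      ≤ ∑ j, D.p j * ∑ i, ((1/2) * v j i ^ 2 + (1/2) * D.Y j i z ^ 2) := by
    refine Finset.sum_le_sum fun j _ => mul_le_mul_of_nonneg_left
      (Finset.sum_le_sum fun i _ => ?_) (D.hp j)
    nlinarith [sq_nonneg (v j i - D.Y j i z)]
  have h3 : ∑ j, D.p j * ∑ i, ((1/2) * v j i ^ 2 + (1/2) * D.Y j i z ^ 2)
      = (1/2) * (∑ j, D.p j * ∑ i, v j i ^ 2) + (1/2) * ∑ j, D.p j * ∑ i, (D.Y j i z) ^ 2 := by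
    simp only [Finset.sum_add_distrib, ← Finset.mul_sum, mul_add]
    congr 1 <;> rw [Finset.mul_sum] <;> exact Finset.sum_congr rfl fun k _ => by ring
  rw [D.frame_sq z] at h3
  linarith

lemma card_eq : (∑ _k : ν, (1:ℝ)) = ∑ j, D.p j * ∑ i, ∑ k, D.l j i k ^ 2 := by
  have : ∀ k : ν, (1:ℝ) = ∑ j, D.p j * ∑ i, D.l j i k * D.l j i k := by
    intro k; rw [D.frame k k]; simp
  rw [Finset.sum_congr rfl fun k _ => this k, Finset.sum_comm]
  refine Finset.sum_congr rfl fun j _ => ?_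
  rw [← Finset.mul_sum, Finset.sum_comm]
  simp only [sq]

lemma r_Er (j : ι) (s : σ j) {r : ℝ} (hr : r ∈ Set.Icc (0:ℝ) 1) (x : ν → ℝ) :
    r * D.Er j s r x = ∑ i, (D.tau j i r - 1) - (2 * Real.pi)⁻¹ * ∑ i, D.q j s i r x ^ 2
      - ∑ i, D.Y j i x * D.q j s i r x := by
  unfold Er
  rw [Finset.mul_sum, Finset.mul_sum, ← Finset.sum_sub_distrib, ← Finset.sum_sub_distrib]
  refine Finset.sum_congr rfl fun i _ => ?_
  have h := D.tau_eq j i hr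
  unfold q
  have hpi := Real.pi_pos.ne'
  set t := D.tau j i r
  set th := D.th j i
  set y := D.Y j i x
  set a := D.a j s i
  have : (2 * Real.pi)⁻¹ * (-(2 * Real.pi) * t * (y - r * a)) ^ 2
     = 2 * Real.pi * t ^ 2 * (y - r * a) ^ 2 := by field_simp
  rw [this]
  linear_combination (1 - 2 * Real.pi * t * (y - r * a) ^ 2) * h

lemma r_Phir {r : ℝ} (hr : r ∈ Set.Icc (0:ℝ) 1) (x : ν → ℝ) :
    r * D.Phir r x = ∑ j, D.p j * (∑ i, (D.tau j i r - 1)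
      - (2 * Real.pi)⁻¹ * (∑ s, D.w j s r x * ∑ i, D.q j s i r x ^ 2)
      - ∑ i, D.Y j i x * D.qb j i r x) := by
  unfold Phir
  rw [Finset.mul_sum]
  refine Finset.sum_congr rfl fun j _ => ?_
  rw [mul_left_comm]
  congr 1
  rw [Finset.mul_sum]
  have : ∀ s, r * (D.w j s r x * D.Er j s r x) = (D.w j s r x) * (∑ i, (D.tau j i r - 1))
      - (2 * Real.pi)⁻¹ * (D.w j s r x * ∑ i, D.q j s i r x ^ 2)
      - ∑ i, D.Y j i x * (D.w j s r x * D.q j s i r x) := by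
    intro s
    rw [mul_left_comm, D.r_Er j s hr x, mul_sub, mul_sub,
      Finset.mul_sum (f := fun i => D.Y j i x * D.q j s i r x)]
    congr 1
    · ring
    · exact Finset.sum_congr rfl fun i _ => by ring
  simp only [this, Finset.sum_sub_distrib, ← Finset.mul_sum, ← Finset.sum_mul, D.w_sum, one_mul]
  congr 1
  rw [Finset.sum_comm]
  exact Finset.sum_congr rfl fun i _ => by rw [← Finset.mul_sum]; rfl

lemma sum_G_x (r : ℝ) (x : ν → ℝ) :
    ∑ k, D.G k r x * x k = ∑ j, D.p j * ∑ i, D.Y j i x * D.qb j i r x := by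
  unfold G Y
  simp only [Finset.sum_mul, Finset.mul_sum]
  rw [Finset.sum_comm]
  refine Finset.sum_congr rfl fun j _ => ?_
  rw [Finset.sum_comm]
  exact Finset.sum_congr rfl fun i _ => Finset.sum_congr rfl fun k _ => by ring

lemma sum_Gk (r : ℝ) (x : ν → ℝ) :
    ∑ k, D.Gk k r x = ∑ j, D.p j * ((∑ s, D.w j s r x * ∑ k, (∑ i, D.q j s i r x * D.l j i k) ^ 2)
      - 2 * Real.pi * (∑ i, D.tau j i r * ∑ k, D.l j i k ^ 2)
      - ∑ k, (∑ i, D.qb j i r x * D.l j i k) ^ 2) := by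
  unfold Gk
  rw [Finset.sum_comm]
  refine Finset.sum_congr rfl fun j _ => ?_
  rw [← Finset.mul_sum]
  congr 1
  have e1 : ∀ k, ∑ s, D.w j s r x * ∑ i', D.l j i' k * D.q j s i' r x
      = ∑ i, D.qb j i r x * D.l j i k := by
    intro k
    unfold qb
    simp only [Finset.mul_sum, Finset.sum_mul]
    rw [Finset.sum_comm]
    exact Finset.sum_congr rfl fun i _ => Finset.sum_congr rfl fun k _ => by ring
  have e2 : ∀ k, ∑ i, D.l j i k * D.qbk j i k r x =
      (∑ s, D.w j s r x * (∑ i, D.q j s i r x * D.l j i k) ^ 2)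
      - 2 * Real.pi * (∑ i, D.tau j i r * D.l j i k ^ 2)
      - (∑ i, D.qb j i r x * D.l j i k) ^ 2 := by
    intro k
    unfold qbk
    simp only [e1]
    simp only [mul_sub, Finset.sum_sub_distrib]
    congr 1
    · simp only [mul_add, Finset.sum_add_distrib, ← Finset.sum_mul, D.w_sum, one_mul]
      rw [sub_eq_add_neg]
      congr 1
      · simp only [Finset.mul_sum, Finset.sum_mul]
        rw [Finset.sum_comm]
        refine Finset.sum_congr rfl fun s _ => ?_
        rw [sq, Finset.sum_mul_sum, Finset.mul_sum]
        refine Finset.sum_congr rfl fun i _ => ?_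
        rw [Finset.mul_sum]
        exact Finset.sum_congr rfl fun k _ => by ring
      · rw [Finset.mul_sum, ← Finset.sum_neg_distrib]
        exact Finset.sum_congr rfl fun k _ => by ring
    · rw [sq, Finset.sum_mul]
      exact Finset.sum_congr rfl fun k _ => by ring
  simp only [e2, Finset.sum_sub_distrib, ← Finset.mul_sum]
  congr 1
  congr 1
  · rw [Finset.sum_comm]
    simp only [Finset.mul_sum]
  · rw [Finset.sum_comm]
    simp only [Finset.mul_sum]

lemma var_ineq (j : ι) (hj : 0 < D.p j) (r : ℝ) (x : ν → ℝ) :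
    (∑ s, D.w j s r x * ∑ k, (∑ i, D.q j s i r x * D.l j i k) ^ 2)
      - ∑ k, (∑ i, D.qb j i r x * D.l j i k) ^ 2 ≤
    (∑ s, D.w j s r x * ∑ i, D.q j s i r x ^ 2) - ∑ i, D.qb j i r x ^ 2 := by
  have h : ∑ s, D.w j s r x * ∑ k, (∑ i, (D.q j s i r x - D.qb j i r x) * D.l j i k) ^ 2
      ≤ ∑ s, D.w j s r x * ∑ i, (D.q j s i r x - D.qb j i r x) ^ 2 :=
    Finset.sum_le_sum fun s _ => mul_le_mul_of_nonneg_left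
      (D.hN j hj fun i => D.q j s i r x - D.qb j i r x) (D.w_nonneg j s r x)
  have e1 : ∑ s, D.w j s r x * ∑ i, (D.q j s i r x - D.qb j i r x) ^ 2
      = (∑ s, D.w j s r x * ∑ i, D.q j s i r x ^ 2) - ∑ i, D.qb j i r x ^ 2 := by
    simp only [Finset.mul_sum]
    rw [Finset.sum_comm, Finset.sum_comm (f := fun s i => D.w j s r x * D.q j s i r x ^ 2),
      ← Finset.sum_sub_distrib]
    exact Finset.sum_congr rfl fun i _ =>
      var_eq (fun s => D.w j s r x) (fun s => D.q j s i r x) (D.w_sum j r x)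
  have e2 : ∑ s, D.w j s r x * ∑ k, (∑ i, (D.q j s i r x - D.qb j i r x) * D.l j i k) ^ 2
      = (∑ s, D.w j s r x * ∑ k, (∑ i, D.q j s i r x * D.l j i k) ^ 2)
      - ∑ k, (∑ i, D.qb j i r x * D.l j i k) ^ 2 := by
    simp only [Finset.mul_sum (s := (Finset.univ : Finset ν))]
    rw [Finset.sum_comm, Finset.sum_comm
      (f := fun s k => D.w j s r x * (∑ i, D.q j s i r x * D.l j i k) ^ 2),
      ← Finset.sum_sub_distrib]
    refine Finset.sum_congr rfl fun k _ => ?_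
    have hq : ∑ i, D.qb j i r x * D.l j i k
        = ∑ s, D.w j s r x * ∑ i, D.q j s i r x * D.l j i k := by
      unfold qb
      simp only [Finset.mul_sum, Finset.sum_mul]
      rw [Finset.sum_comm]
      exact Finset.sum_congr rfl fun i _ => Finset.sum_congr rfl fun k _ => by ring
    simp only [sub_mul, Finset.sum_sub_distrib, hq]
    exact var_eq (fun s => D.w j s r x) (fun s => ∑ i, D.q j s i r x * D.l j i k) (D.w_sum j r x)
  rw [e1, e2] at h
  exact h

lemma tau_ell (j : ι) (hj : 0 < D.p j) (r : ℝ) :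
    ∑ i, (D.tau j i r - 1) + ∑ i, ∑ k, D.l j i k ^ 2 - ∑ i, D.tau j i r * ∑ k, D.l j i k ^ 2 = 0 := by
  rw [← Finset.sum_add_distrib, ← Finset.sum_sub_distrib]
  refine Finset.sum_eq_zero fun i _ => ?_
  rcases D.hE j hj i with h | h
  · have : D.tau j i r = 1 := by simp [tau, h]
    rw [this]; ring
  · rw [h]; ring

lemma pointwise {r : ℝ} (hr : r ∈ Set.Icc (0:ℝ) 1) (x : ν → ℝ) :
    r * (D.rho r x * D.Phir r x) ≤ - ∑ k, D.Vk k r x := by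
  have hpi := Real.pi_pos
  have key : r * D.Phir r x + ∑ k, (D.G k r x * (x k + (2 * Real.pi)⁻¹ * D.G k r x)
    + (1 + (2 * Real.pi)⁻¹ * D.Gk k r x)) ≤ 0 := by
    have e : ∑ k, (D.G k r x * (x k + (2 * Real.pi)⁻¹ * D.G k r x)
        + (1 + (2 * Real.pi)⁻¹ * D.Gk k r x))
        = ∑ k, D.G k r x * x k + (2 * Real.pi)⁻¹ * ∑ k, D.G k r x ^ 2 + ∑ _k : ν, (1:ℝ)
          + (2 * Real.pi)⁻¹ * ∑ k, D.Gk k r x := by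
      simp only [Finset.mul_sum, ← Finset.sum_add_distrib]
      exact Finset.sum_congr rfl fun k _ => by ring
    rw [e, D.r_Phir hr x, D.sum_G_x, D.card_eq, D.sum_Gk]
    have hG : ∑ k, D.G k r x ^ 2 ≤ ∑ j, D.p j * ∑ i, D.qb j i r x ^ 2 :=
      D.sum_sq_le (fun j i => D.qb j i r x)
    have hG' := mul_le_mul_of_nonneg_left hG (inv_pos.2 (mul_pos two_pos hpi)).le
    have main : ∀ j, D.p j * (∑ i, (D.tau j i r - 1)
      - (2 * Real.pi)⁻¹ * (∑ s, D.w j s r x * ∑ i, D.q j s i r x ^ 2)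
      - ∑ i, D.Y j i x * D.qb j i r x) + D.p j * ∑ i, D.Y j i x * D.qb j i r x
      + (2 * Real.pi)⁻¹ * (D.p j * ∑ i, D.qb j i r x ^ 2)
      + D.p j * ∑ i, ∑ k, D.l j i k ^ 2
      + (2 * Real.pi)⁻¹ * (D.p j *
        ((∑ s, D.w j s r x * ∑ k, (∑ i, D.q j s i r x * D.l j i k) ^ 2)
        - 2 * Real.pi * (∑ i, D.tau j i r * ∑ k, D.l j i k ^ 2)
        - ∑ k, (∑ i, D.qb j i r x * D.l j i k) ^ 2)) ≤ 0 := by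
      intro j
      rcases (D.hp j).eq_or_lt with h0 | hj
      · rw [← h0]; simp
      · have h1 := D.var_ineq j hj r x
        have h2 := D.tau_ell j hj r
        have h3 := mul_le_mul_of_nonneg_left h1
          (mul_pos (inv_pos.2 (mul_pos two_pos hpi)) hj).le
        have h4 : (2 * Real.pi)⁻¹ * (2 * Real.pi) = 1 :=
          inv_mul_cancel₀ (mul_pos two_pos hpi).ne'
        set P := (2 * Real.pi)⁻¹
        linear_combination h3 + D.p j * h2
          - D.p j * (∑ i, D.tau j i r * ∑ k, D.l j i k ^ 2) * h4
    have := Finset.sum_le_sum fun j (_ : j ∈ Finset.univ) => main j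
    simp only [Finset.sum_add_distrib, ← Finset.mul_sum, Finset.sum_const_zero] at this
    linarith
  have hs : ∑ k, D.Vk k r x = D.rho r x * ∑ k, (D.G k r x * (x k + (2 * Real.pi)⁻¹ * D.G k r x)
    + (1 + (2 * Real.pi)⁻¹ * D.Gk k r x)) := by
    unfold Vk
    rw [Finset.mul_sum]
  rw [hs]
  have hrho : 0 < D.rho r x := Real.exp_pos _
  nlinarith [mul_le_mul_of_nonneg_left key hrho.le]

end Dat
end BLC

namespace BLC

section SGsec
variable {ν : Type} [Fintype ν]

/-- sub-Gaussian growth, uniformly in the parameter -/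
def SG (f : ℝ → (ν → ℝ) → ℝ) : Prop :=
  ∀ ε : ℝ, 0 < ε → ∃ C : ℝ, ∀ r ∈ Set.Icc (0:ℝ) 1, ∀ x, |f r x| ≤ C * Real.exp (ε * ∑ k, x k ^ 2)

lemma one_le_exp_sq {ε : ℝ} (hε : 0 < ε) (x : ν → ℝ) : 1 ≤ Real.exp (ε * ∑ k, x k ^ 2) := by
  apply Real.one_le_exp
  exact mul_nonneg hε.le (Finset.sum_nonneg fun k _ => sq_nonneg _)

lemma SG.of_bdd {f : ℝ → (ν → ℝ) → ℝ} (C : ℝ)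
    (h : ∀ r ∈ Set.Icc (0:ℝ) 1, ∀ x, |f r x| ≤ C) : SG f := by
  intro ε hε
  refine ⟨C, fun r hr x => (h r hr x).trans ?_⟩
  have hC : 0 ≤ C := (abs_nonneg _).trans (h r hr x)
  nlinarith [one_le_exp_sq hε x]

lemma SG.const (c : ℝ) : SG (fun _ (_ : ν → ℝ) => c) := SG.of_bdd |c| fun _ _ _ => le_rfl

lemma SG.add {f g : ℝ → (ν → ℝ) → ℝ} (hf : SG f) (hg : SG g) : SG (fun r x => f r x + g r x) := by
  intro ε hε
  obtain ⟨C, hC⟩ := hf ε hε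
  obtain ⟨C', hC'⟩ := hg ε hε
  refine ⟨C + C', fun r hr x => (abs_add_le _ _).trans ?_⟩
  rw [add_mul]
  exact add_le_add (hC r hr x) (hC' r hr x)

lemma SG.mul {f g : ℝ → (ν → ℝ) → ℝ} (hf : SG f) (hg : SG g) : SG (fun r x => f r x * g r x) := by
  intro ε hε
  obtain ⟨C, hC⟩ := hf (ε / 2) (by positivity)
  obtain ⟨C', hC'⟩ := hg (ε / 2) (by positivity)
  refine ⟨C * C', fun r hr x => ?_⟩
  rw [abs_mul]
  calc |f r x| * |g r x| ≤ (C * Real.exp (ε / 2 * ∑ k, x k ^ 2)) * (C' * Real.exp (ε / 2 * ∑ k, x k ^ 2)) :=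
        mul_le_mul (hC r hr x) (hC' r hr x) (abs_nonneg _) ((abs_nonneg _).trans (hC r hr x))
    _ = C * C' * Real.exp (ε * ∑ k, x k ^ 2) := by
        rw [mul_mul_mul_comm, ← Real.exp_add]; ring_nf

lemma SG.neg {f : ℝ → (ν → ℝ) → ℝ} (hf : SG f) : SG (fun r x => - f r x) := by
  intro ε hε
  obtain ⟨C, hC⟩ := hf ε hε
  exact ⟨C, fun r hr x => by rw [abs_neg]; exact hC r hr x⟩

lemma SG.sub {f g : ℝ → (ν → ℝ) → ℝ} (hf : SG f) (hg : SG g) : SG (fun r x => f r x - g r x) := by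
  simpa [sub_eq_add_neg] using hf.add hg.neg

lemma SG.sum {S : Type*} (t : Finset S) {f : S → ℝ → (ν → ℝ) → ℝ} (hf : ∀ s, SG (f s)) :
    SG (fun r x => ∑ s ∈ t, f s r x) := by
  classical
  induction t using Finset.induction_on with
  | empty => simpa using SG.const (ν := ν) 0
  | insert a t ha ih =>
    simp only [Finset.sum_insert ha]
    exact (hf a).add ih

lemma SG.pow {f : ℝ → (ν → ℝ) → ℝ} (hf : SG f) (n : ℕ) : SG (fun r x => f r x ^ n) := by
  induction n with
  | zero => simpa using SG.const (ν := ν) 1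
  | succ n ih => simpa only [pow_succ] using ih.mul hf

lemma SG.coord (k : ν) : SG (fun _ (x : ν → ℝ) => x k) := by
  intro ε hε
  refine ⟨1 / (4 * ε) + 1, fun r _ x => ?_⟩
  have h1 := Real.add_one_le_exp (ε * ∑ k, x k ^ 2)
  have h2 : x k ^ 2 ≤ ∑ k, x k ^ 2 :=
    Finset.single_le_sum (f := fun k => x k ^ 2) (fun k _ => sq_nonneg _) (Finset.mem_univ k)
  have h3 : |x k| ≤ 1 / (4 * ε) + ε * (x k ^ 2) := by
    rw [← sq_abs (x k)]
    have : 1 / (4 * ε) + ε * |x k| ^ 2 - |x k| = (2 * ε * |x k| - 1) ^ 2 / (4 * ε) := by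
      field_simp; ring
    have h4 : 0 ≤ (2 * ε * |x k| - 1) ^ 2 / (4 * ε) := by positivity
    linarith
  have h5 : ε * x k ^ 2 ≤ ε * ∑ k, x k ^ 2 := mul_le_mul_of_nonneg_left h2 hε.le
  have h6 : 0 < 1 / (4 * ε) := by positivity
  have h7 := one_le_exp_sq hε x
  nlinarith

lemma integrable_gauss (ε : ℝ) (hε : 0 < ε) :
    Integrable (fun x : ν → ℝ => Real.exp (-ε * ∑ k, x k ^ 2)) := by
  have : (fun x : ν → ℝ => Real.exp (-ε * ∑ k, x k ^ 2)) = fun x => ∏ k, Real.exp (-ε * x k ^ 2) := by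
    funext x; rw [Finset.mul_sum, Real.exp_sum]
  rw [this]
  exact Integrable.fintype_prod (f := fun _ (y : ℝ) => Real.exp (-ε * y ^ 2))
    (fun _ => integrable_exp_neg_mul_sq hε)

lemma integral_gauss_one : ∫ x : ν → ℝ, Real.exp (-Real.pi * ∑ k, x k ^ 2) = 1 := by
  have : (fun x : ν → ℝ => Real.exp (-Real.pi * ∑ k, x k ^ 2)) = fun x => ∏ k, Real.exp (-Real.pi * x k ^ 2) := by
    funext x; rw [Finset.mul_sum, Real.exp_sum]
  rw [this]
  rw [integral_fintype_prod_volume_eq_prod (f := fun _ (y : ℝ) => Real.exp (-Real.pi * y ^ 2))]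
  simp only [integral_gaussian, div_self Real.pi_ne_zero, Real.sqrt_one, Finset.prod_const_one]

end SGsec

namespace Dat
variable {ι ν : Type} {κ σ : ι → Type} [Fintype ι] [Fintype ν] [DecidableEq ν]
    [∀ j, Fintype (κ j)] [∀ j, Fintype (σ j)] (D : Dat ι ν κ σ)

lemma sg_tau (j : ι) (i : κ j) : SG (fun r (_ : ν → ℝ) => D.tau j i r) :=
  SG.of_bdd (D.th j i)⁻¹ fun r hr _ => by
    rw [abs_of_pos (D.tau_pos j i hr)]; exact D.tau_le j i hr

lemma sg_r : SG (fun r (_ : ν → ℝ) => r) :=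
  SG.of_bdd 1 fun r hr _ => by rw [abs_of_nonneg hr.1]; exact hr.2

lemma sg_Y (j : ι) (i : κ j) : SG (fun _ x => D.Y j i x) :=
  SG.sum _ fun k => (SG.const _).mul (SG.coord k)

lemma sg_ya (j : ι) (s : σ j) (i : κ j) : SG (fun r x => D.Y j i x - r * D.a j s i) :=
  (D.sg_Y j i).sub (sg_r.mul (SG.const _))

lemma sg_q (j : ι) (s : σ j) (i : κ j) : SG (D.q j s i) :=
  ((SG.const _).mul (D.sg_tau j i)).mul (D.sg_ya j s i)

lemma sg_w (j : ι) (s : σ j) : SG (D.w j s) :=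
  SG.of_bdd 1 fun r _ x => by
    rw [abs_of_nonneg (D.w_nonneg j s r x), ← D.w_sum j r x]
    exact Finset.single_le_sum (f := fun s => D.w j s r x) (fun s _ => D.w_nonneg j s r x)
      (Finset.mem_univ s)

lemma sg_qb (j : ι) (i : κ j) : SG (D.qb j i) :=
  SG.sum _ fun s => (D.sg_w j s).mul (D.sg_q j s i)

lemma sg_Er (j : ι) (s : σ j) : SG (D.Er j s) := by
  refine SG.sum _ fun i => SG.add (SG.sub ?_ ?_) ?_
  · exact (sg_r.mul (SG.const _)).mul (D.sg_tau j i)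
  · exact ((SG.const _).mul ((((SG.const _).mul sg_r).mul (SG.const _)).mul ((D.sg_tau j i).pow 2))).mul
      ((D.sg_ya j s i).pow 2)
  · exact (((SG.const _).mul (D.sg_tau j i)).mul (SG.const _)).mul (D.sg_ya j s i)

lemma sg_Phir : SG D.Phir :=
  SG.sum _ fun j => (SG.const _).mul (SG.sum _ fun s => (D.sg_w j s).mul (D.sg_Er j s))

lemma sg_G (k : ν) : SG (D.G k) :=
  SG.sum _ fun j => (SG.const _).mul (SG.sum _ fun i => (SG.const _).mul (D.sg_qb j i))

lemma sg_qbk (j : ι) (i : κ j) (k : ν) : SG (D.qbk j i k) := by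
  have h : ∀ s, SG (fun r x => ∑ i', D.l j i' k * D.q j s i' r x) := fun s =>
    SG.sum _ fun i' => (SG.const _).mul (D.sg_q j s i')
  refine SG.sub (SG.sum _ fun s => (D.sg_w j s).mul (SG.add ((h s).mul (D.sg_q j s i)) ?_)) ?_
  · exact ((SG.const _).mul (D.sg_tau j i)).mul (SG.const _)
  · exact (D.sg_qb j i).mul (SG.sum _ fun s => (D.sg_w j s).mul (h s))

lemma sg_Gk (k : ν) : SG (D.Gk k) :=
  SG.sum _ fun j => (SG.const _).mul (SG.sum _ fun i => (SG.const _).mul (D.sg_qbk j i k))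

/-! continuity in `x` -/
lemma cont_Y (j : ι) (i : κ j) : Continuous (D.Y j i) := by unfold Y; fun_prop
lemma cont_q (j : ι) (s : σ j) (i : κ j) (r : ℝ) : Continuous (D.q j s i r) := by
  have := D.cont_Y j i
  unfold q; fun_prop
lemma cont_E (j : ι) (s : σ j) (r : ℝ) : Continuous (D.E j s r) := by
  have := D.cont_Y j
  unfold E; fun_prop
lemma cont_Er (j : ι) (s : σ j) (r : ℝ) : Continuous (D.Er j s r) := by
  have := D.cont_Y j
  unfold Er; fun_prop
lemma cont_u (j : ι) (r : ℝ) : Continuous (D.u j r) := by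
  have := fun s => D.cont_E j s r
  unfold u; fun_prop
lemma cont_w (j : ι) (s : σ j) (r : ℝ) : Continuous (D.w j s r) := by
  have := D.cont_E j s r
  exact Continuous.div (by fun_prop) (D.cont_u j r) fun x => (D.u_pos j r x).ne'
lemma cont_qb (j : ι) (i : κ j) (r : ℝ) : Continuous (D.qb j i r) :=
  continuous_finsetSum _ fun s _ => (D.cont_w j s r).mul (D.cont_q j s i r)
lemma cont_rho (r : ℝ) : Continuous (D.rho r) :=
  Real.continuous_exp.comp <| continuous_finsetSum _ fun j _ => continuous_const.mul <|
    (D.cont_u j r).log fun x => (D.u_pos j r x).ne'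
lemma cont_Phir (r : ℝ) : Continuous (D.Phir r) :=
  continuous_finsetSum _ fun j _ => continuous_const.mul <|
    continuous_finsetSum _ fun s _ => (D.cont_w j s r).mul (D.cont_Er j s r)
lemma cont_G (k : ν) (r : ℝ) : Continuous (D.G k r) :=
  continuous_finsetSum _ fun j _ => continuous_const.mul <|
    continuous_finsetSum _ fun i _ => continuous_const.mul (D.cont_qb j i r)
lemma cont_qbk (j : ι) (i : κ j) (k : ν) (r : ℝ) : Continuous (D.qbk j i k r) := by
  have h1 := fun s i => D.cont_q j s i r
  have h2 := fun s => D.cont_w j s r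
  have h3 := D.cont_qb j i r
  unfold qbk; fun_prop
lemma cont_Gk (k : ν) (r : ℝ) : Continuous (D.Gk k r) :=
  continuous_finsetSum _ fun j _ => continuous_const.mul <|
    continuous_finsetSum _ fun i _ => continuous_const.mul (D.cont_qbk j i k r)

/-- Gaussian bound on `ρ` -/
lemma rho_bound : ∃ C : ℝ, 0 < C ∧ ∀ r ∈ Set.Icc (0:ℝ) 1, ∀ x,
    D.rho r x ≤ C * Real.exp (-(Real.pi / 2) * ∑ k, x k ^ 2) := by
  have hu : ∀ j, ∃ A : ℝ, ∀ r ∈ Set.Icc (0:ℝ) 1, ∀ x,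
      Real.log (D.u j r x) ≤ A - (Real.pi / 2) * ∑ i, D.Y j i x ^ 2 := by
    intro j
    have hs : ∀ s, ∃ B : ℝ, ∀ r ∈ Set.Icc (0:ℝ) 1, ∀ x,
        D.E j s r x ≤ B - (Real.pi / 2) * ∑ i, D.Y j i x ^ 2 := by
      intro s
      refine ⟨∑ i, ((1/2) * Real.log (D.th j i)⁻¹ + Real.pi * D.a j s i ^ 2), fun r hr x => ?_⟩
      unfold E
      rw [Finset.mul_sum, ← Finset.sum_sub_distrib]
      refine Finset.sum_le_sum fun i _ => ?_
      have h1 := Real.log_le_log (D.tau_pos j i hr) (D.tau_le j i hr)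
      have h2 := D.one_le_tau j i hr
      have h3 : Real.pi * (D.Y j i x - r * D.a j s i) ^ 2 ≤
          Real.pi * D.tau j i r * (D.Y j i x - r * D.a j s i) ^ 2 := by
        apply mul_le_mul_of_nonneg_right _ (sq_nonneg _)
        nlinarith [Real.pi_pos]
      have h4 : D.Y j i x ^ 2 / 2 - D.a j s i ^ 2 ≤ (D.Y j i x - r * D.a j s i) ^ 2 := by
        have h5 : (r * D.a j s i) ^ 2 ≤ D.a j s i ^ 2 := by
          rw [mul_pow]
          have : r ^ 2 ≤ 1 := by nlinarith [hr.1, hr.2]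
          nlinarith [sq_nonneg (D.a j s i)]
        nlinarith [sq_nonneg (D.Y j i x - 2 * (r * D.a j s i))]
      have h6 := mul_le_mul_of_nonneg_left h4 Real.pi_pos.le
      nlinarith
    choose B hB using hs
    have hpos := wsum_pos (D.c0 j) (D.c1 j) B
    refine ⟨Real.log (∑ s, D.c j s * Real.exp (B s)), fun r hr x => ?_⟩
    have : D.u j r x ≤ (∑ s, D.c j s * Real.exp (B s)) * Real.exp (-((Real.pi / 2) * ∑ i, D.Y j i x ^ 2)) := by
      unfold u
      rw [Finset.sum_mul]
      refine Finset.sum_le_sum fun s _ => ?_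
      rw [mul_assoc, ← Real.exp_add]
      exact mul_le_mul_of_nonneg_left (Real.exp_le_exp.2 (by have := hB s r hr x; linarith)) (D.c0 j s)
    have h := Real.log_le_log (D.u_pos j r x) this
    rw [Real.log_mul hpos.ne' (Real.exp_pos _).ne', Real.log_exp] at h
    linarith
  choose A hA using hu
  refine ⟨Real.exp (∑ j, D.p j * A j), Real.exp_pos _, fun r hr x => ?_⟩
  unfold rho
  rw [← Real.exp_add]
  apply Real.exp_le_exp.2
  rw [← D.frame_sq x, Finset.mul_sum, ← Finset.sum_add_distrib]
  unfold Phi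
  refine Finset.sum_le_sum fun j _ => ?_
  have := mul_le_mul_of_nonneg_left (hA j r hr x) (D.hp j)
  linarith

lemma rho_mul_bound {f : ℝ → (ν → ℝ) → ℝ} (hf : SG f) : ∃ C : ℝ, ∀ r ∈ Set.Icc (0:ℝ) 1, ∀ x,
    ‖D.rho r x * f r x‖ ≤ C * Real.exp (-(1:ℝ) * ∑ k, x k ^ 2) := by
  obtain ⟨C, hC, h⟩ := D.rho_bound
  obtain ⟨C', h'⟩ := hf (1/2) (by norm_num)
  refine ⟨C * C', fun r hr x => ?_⟩
  have h0 : 0 ≤ D.rho r x := (Real.exp_pos _).le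
  have hs : 0 ≤ ∑ k, x k ^ 2 := Finset.sum_nonneg fun k _ => sq_nonneg _
  rw [norm_mul, Real.norm_of_nonneg h0, Real.norm_eq_abs]
  have h3 : 0 ≤ C' := by
    have := (abs_nonneg _).trans (h' r hr x)
    exact nonneg_of_mul_nonneg_left this (Real.exp_pos _)
  calc D.rho r x * |f r x| ≤ (C * Real.exp (-(Real.pi / 2) * ∑ k, x k ^ 2)) * (C' * Real.exp (1/2 * ∑ k, x k ^ 2)) :=
        mul_le_mul (h r hr x) (h' r hr x) (abs_nonneg _) (h0.trans (h r hr x))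
    _ = C * C' * Real.exp (-(Real.pi / 2) * (∑ k, x k ^ 2) + 1/2 * ∑ k, x k ^ 2) := by
        rw [mul_mul_mul_comm, ← Real.exp_add]
    _ ≤ _ := by
        apply mul_le_mul_of_nonneg_left _ (mul_nonneg hC.le h3)
        apply Real.exp_le_exp.2
        nlinarith [Real.pi_gt_three]

lemma integrable_rho_mul {f : ℝ → (ν → ℝ) → ℝ} (hf : SG f) {r : ℝ} (hr : r ∈ Set.Icc (0:ℝ) 1)
    (hc : Continuous (f r)) : Integrable (fun x => D.rho r x * f r x) := by
  obtain ⟨C, hC⟩ := D.rho_mul_bound hf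
  exact ((integrable_gauss 1 one_pos).const_mul C).mono'
    ((D.cont_rho r).mul hc).aestronglyMeasurable (Filter.Eventually.of_forall (hC r hr))

lemma integral_Vk (k : ν) {r : ℝ} (hr : r ∈ Set.Icc (0:ℝ) 1) :
    Integrable (D.Vk k r) ∧ ∫ x, D.Vk k r x = 0 := by
  have hz : SG (fun r x => x k + (2 * Real.pi)⁻¹ * D.G k r x) :=
    (SG.coord k).add ((SG.const _).mul (D.sg_G k))
  have hzc : Continuous (fun x : ν → ℝ => x k + (2 * Real.pi)⁻¹ * D.G k r x) := by
    have := D.cont_G k r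
    fun_prop
  have h1 : Integrable (D.V k r) := D.integrable_rho_mul hz hr hzc
  have h2 : Integrable (D.Vk k r) := by
    refine D.integrable_rho_mul (f := fun r x => (D.G k r x * (x k + (2 * Real.pi)⁻¹ * D.G k r x)
      + (1 + (2 * Real.pi)⁻¹ * D.Gk k r x))) ?_ hr ?_
    · exact ((D.sg_G k).mul hz).add ((SG.const 1).add ((SG.const _).mul (D.sg_Gk k)))
    · have := D.cont_G k r
      have := D.cont_Gk k r
      fun_prop
  refine ⟨h2, ?_⟩
  have := integral_bilinear_hasLineDerivAt_right_eq_neg_left_of_integrable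
    (μ := (volume : Measure (ν → ℝ))) (f := fun _ => (1:ℝ))
    (f' := fun _ => 0) (g := D.V k r) (g' := D.Vk k r) (v := Pi.single k 1)
    (B := ContinuousLinearMap.mul ℝ ℝ) (by simp) (by simpa using h2) (by simpa using h1)
    (fun x _ => by unfold HasLineDerivAt; exact hasDerivAt_const _ _)
    (fun x _ => D.hasLineDerivAt_V k r x)
  simpa using this

lemma hasDerivAt_rho {r : ℝ} (hr : r ∈ Set.Icc (0:ℝ) 1) (x : ν → ℝ) :
    HasDerivAt (fun r => D.rho r x) (D.rho r x * D.Phir r x) r :=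
  (D.hasDerivAt_Phi hr x).exp

theorem mono : ∫ x, D.rho 1 x ≤ ∫ x, D.rho 0 x := by
  have hintg : ∀ r ∈ Set.Icc (0:ℝ) 1, Integrable (D.rho r) := fun r hr => by
    simpa using D.integrable_rho_mul (SG.const 1) hr continuous_const
  have hcont : ContinuousOn (fun r => ∫ x, D.rho r x) (Set.Icc 0 1) := by
    obtain ⟨C, hC⟩ := D.rho_mul_bound (SG.const 1)
    have hC' : ∀ r ∈ Set.Icc (0:ℝ) 1, ∀ x, ‖D.rho r x‖ ≤ C * Real.exp (-(1:ℝ) * ∑ k, x k ^ 2) := by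
      intro r hr x
      have := hC r hr x
      rwa [mul_one] at this
    have hco : ∀ x, ContinuousOn (fun r => D.rho r x) (Set.Icc 0 1) := fun x r hr =>
      (D.hasDerivAt_rho hr x).continuousAt.continuousWithinAt
    exact continuousOn_of_dominated (F := fun r x => D.rho r x) (bound := fun x => C * Real.exp (-(1:ℝ) * ∑ k, x k ^ 2))
      (fun r _ => (D.cont_rho r).aestronglyMeasurable)
      (fun r hr => Filter.Eventually.of_forall fun x => hC' r hr x)
      ((integrable_gauss 1 one_pos).const_mul C)
      (Filter.Eventually.of_forall hco)
  have hder : ∀ r ∈ Set.Ioo (0:ℝ) 1,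
      HasDerivAt (fun r => ∫ x, D.rho r x) (∫ x, D.rho r x * D.Phir r x) r := by
    intro r hr
    obtain ⟨C, hC⟩ := D.rho_mul_bound D.sg_Phir
    have hr' := Set.Ioo_subset_Icc_self hr
    refine (hasDerivAt_integral_of_dominated_loc_of_deriv_le (F := D.rho)
      (F' := fun r x => D.rho r x * D.Phir r x)
      (bound := fun x => C * Real.exp (-(1:ℝ) * ∑ k, x k ^ 2)) (s := Set.Icc 0 1)
      (Icc_mem_nhds hr.1 hr.2)
      (Filter.Eventually.of_forall fun r => (D.cont_rho r).aestronglyMeasurable)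
      (hintg r hr') ((D.cont_rho r).mul (D.cont_Phir r)).aestronglyMeasurable
      (Filter.Eventually.of_forall fun x r hr => hC r hr x)
      ((integrable_gauss 1 one_pos).const_mul C)
      (Filter.Eventually.of_forall fun x r hr => D.hasDerivAt_rho hr x)).2
  have hneg : ∀ r ∈ Set.Ioo (0:ℝ) 1, ∫ x, D.rho r x * D.Phir r x ≤ 0 := by
    intro r hr
    have hr' := Set.Ioo_subset_Icc_self hr
    have h1 : ∫ x, r * (D.rho r x * D.Phir r x) ≤ ∫ x, -∑ k, D.Vk k r x :=
      integral_mono ((D.integrable_rho_mul D.sg_Phir hr' (D.cont_Phir r)).const_mul r)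
        (integrable_finsetSum _ fun k _ => (D.integral_Vk k hr').1).neg
        (fun x => D.pointwise hr' x)
    rw [integral_neg, integral_finsetSum _ fun k _ => (D.integral_Vk k hr').1,
      Finset.sum_eq_zero (fun k _ => (D.integral_Vk k hr').2), integral_const_mul, neg_zero] at h1
    exact nonpos_of_mul_nonpos_right h1 hr.1
  have := antitoneOn_of_deriv_nonpos (convex_Icc (0:ℝ) 1) hcont
    (by rw [interior_Icc]; exact fun r hr => (hder r hr).differentiableAt.differentiableWithinAt)
    (by rw [interior_Icc]; exact fun r hr => by rw [(hder r hr).deriv]; exact hneg r hr)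
  exact this (Set.left_mem_Icc.2 zero_le_one) (Set.right_mem_Icc.2 zero_le_one) zero_le_one

lemma rho_eq (r : ℝ) (x : ν → ℝ) : D.rho r x = ∏ j, D.u j r x ^ D.p j := by
  unfold rho Phi
  rw [Real.exp_sum]
  refine Finset.prod_congr rfl fun j _ => ?_
  rw [Real.rpow_def_of_pos (D.u_pos j r x), mul_comm]

lemma rho_zero (x : ν → ℝ) :
    D.rho 0 x = (∏ j, (∑ s, D.c j s) ^ D.p j) * Real.exp (-Real.pi * ∑ k, x k ^ 2) := by
  rw [rho_eq, ← D.frame_sq x, Finset.mul_sum, Real.exp_sum, ← Finset.prod_mul_distrib]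
  refine Finset.prod_congr rfl fun j _ => ?_
  have : D.u j 0 x = (∑ s, D.c j s) * Real.exp (-Real.pi * ∑ i, D.Y j i x ^ 2) := by
    unfold u
    rw [Finset.sum_mul]
    refine Finset.sum_congr rfl fun s _ => ?_
    congr 2
    unfold E tau
    rw [Finset.mul_sum]
    refine Finset.sum_congr rfl fun i _ => ?_
    simp
  rw [this, Real.mul_rpow (Finset.sum_nonneg fun s _ => D.c0 j s) (Real.exp_pos _).le, ← Real.exp_mul]
  ring_nf

theorem core : ∫ x, D.rho 1 x ≤ ∏ j, (∑ s, D.c j s) ^ D.p j := by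
  refine D.mono.trans (le_of_eq ?_)
  simp_rw [D.rho_zero]
  rw [integral_const_mul, integral_gauss_one, mul_one]

lemma u_one (j : ι) (x : ν → ℝ) : D.u j 1 x = ∑ s, D.c j s *
    ∏ i, ((Real.sqrt (D.th j i))⁻¹ * Real.exp (-Real.pi * (D.Y j i x - D.a j s i) ^ 2 / D.th j i)) := by
  unfold u
  refine Finset.sum_congr rfl fun s _ => ?_
  unfold E
  rw [Real.exp_sum]
  congr 1
  refine Finset.prod_congr rfl fun i _ => ?_
  have ht := D.th0 j i
  have h1 : D.tau j i 1 = (D.th j i)⁻¹ := by unfold tau; congr 1; ring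
  rw [h1, sub_eq_add_neg, Real.exp_add]
  congr 1
  · rw [Real.log_inv, Real.sqrt_eq_rpow, ← Real.rpow_neg ht.le, Real.rpow_def_of_pos ht]
    congr 1; ring
  · congr 1
    field_simp

/-- lower-integral form of the core inequality -/
theorem core' : ∫⁻ x, ENNReal.ofReal (∏ j, (∑ s, D.c j s *
    ∏ i, ((Real.sqrt (D.th j i))⁻¹ * Real.exp (-Real.pi * (D.Y j i x - D.a j s i) ^ 2 / D.th j i))) ^ D.p j)
    ≤ ENNReal.ofReal (∏ j, (∑ s, D.c j s) ^ D.p j) := by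
  have h1 : Integrable (D.rho 1) := by
    simpa using D.integrable_rho_mul (SG.const 1) (Set.right_mem_Icc.2 zero_le_one) continuous_const
  have h := ofReal_integral_eq_lintegral_ofReal h1
    (Filter.Eventually.of_forall fun x => (Real.exp_pos _).le)
  refine le_trans (le_of_eq ?_) (ENNReal.ofReal_le_ofReal D.core)
  rw [h]
  refine lintegral_congr fun x => ?_
  rw [rho_eq]
  simp_rw [u_one]

end Dat
end BLC

namespace BLC
open Matrix

/-- A Cauchy-Binet type expansion. -/
lemma cauchy_binet {K ν : Type} [Fintype K] [Fintype ν] [DecidableEq ν]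
    (w : K → ℝ) (v : K → ν → ℝ) :
    ((Fintype.card ν).factorial : ℝ) * (Matrix.of fun a b => ∑ k, w k * v k a * v k b).det
      = ∑ f : ν → K, (∏ a, w (f a)) * (Matrix.of fun b a => v (f a) b).det ^ 2 := by
  classical
  have h1 : (Matrix.of fun a b => ∑ k, w k * v k a * v k b).det
      = ∑ f : ν → K, (∏ a, w (f a)) * (∏ a, v (f a) a) * (Matrix.of fun b a => v (f a) b).det := by
    rw [Matrix.det_apply']
    simp only [Matrix.of_apply, Finset.prod_univ_sum, Fintype.piFinset_univ, Finset.mul_sum]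
    rw [Finset.sum_comm]
    refine Finset.sum_congr rfl fun f _ => ?_
    rw [Matrix.det_apply', Finset.mul_sum]
    refine Finset.sum_congr rfl fun s _ => ?_
    simp only [Matrix.of_apply, Finset.prod_mul_distrib]
    ring
  have h2 : ∀ π : Equiv.Perm ν, (Matrix.of fun a b => ∑ k, w k * v k a * v k b).det
      = ∑ f : ν → K, (∏ a, w (f a)) * ((Equiv.Perm.sign π : ℤ) * ∏ a, v (f (π a)) a) *
          (Matrix.of fun b a => v (f a) b).det := by
    intro π
    rw [h1, ← Equiv.sum_comp (Equiv.arrowCongr π (Equiv.refl K)).symm]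
    refine Finset.sum_congr rfl fun f _ => ?_
    have e : ∀ a, (Equiv.arrowCongr π (Equiv.refl K)).symm f a = f (π a) := fun a => rfl
    simp only [e]
    rw [Equiv.prod_comp π (fun a => w (f a))]
    have : (Matrix.of fun b a => v (f (π a)) b) = (Matrix.of fun b a => v (f a) b).submatrix id π := rfl
    rw [this, Matrix.det_permute']
    ring
  have h3 : ((Fintype.card ν).factorial : ℝ) * (Matrix.of fun a b => ∑ k, w k * v k a * v k b).det
      = ∑ _π : Equiv.Perm ν, (Matrix.of fun a b => ∑ k, w k * v k a * v k b).det := by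
    rw [Finset.sum_const, Finset.card_univ, Fintype.card_perm, nsmul_eq_mul]
  rw [h3, Finset.sum_congr rfl fun π _ => h2 π, Finset.sum_comm]
  refine Finset.sum_congr rfl fun f _ => ?_
  rw [← Finset.sum_mul, ← Finset.mul_sum, sq, ← mul_assoc]
  congr 2
  rw [← Matrix.det_transpose, Matrix.det_apply']
  rfl

section GB
variable {ι ν : Type} {κ : ι → Type} [Fintype ι] [Fintype ν] [DecidableEq ν]
  [∀ j, Fintype (κ j)] [∀ j, DecidableEq (κ j)]

/-- the quadratic form of a Gaussian input -/
noncomputable def GM (p : ι → ℝ) (L : ∀ j, Matrix (κ j) ν ℝ) (U : ∀ j, Matrix (κ j) (κ j) ℝ)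
    (b : ∀ j, κ j → ℝ) : Matrix ν ν ℝ :=
  Matrix.of fun x y => ∑ k : (Σ j, κ j), (p k.1 * b k.1 k.2) * (U k.1 * L k.1) k.2 x * (U k.1 * L k.1) k.2 y

/-- Gaussian Brascamp-Lieb inequality with constant `D` -/
def GB (p : ι → ℝ) (L : ∀ j, Matrix (κ j) ν ℝ) (D : ℝ) : Prop :=
  ∀ U : ∀ j, Matrix (κ j) (κ j) ℝ, (∀ j, U j ∈ Matrix.orthogonalGroup (κ j) ℝ) →
    ∀ b : ∀ j, κ j → ℝ, (∀ j i, 0 < b j i) →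
      ∏ j, (∏ i, b j i) ^ p j ≤ D * (GM p L U b).det

lemma GM_det (p : ι → ℝ) (L : ∀ j, Matrix (κ j) ν ℝ) (U : ∀ j, Matrix (κ j) (κ j) ℝ)
    (b : ∀ j, κ j → ℝ) : ((Fintype.card ν).factorial : ℝ) * (GM p L U b).det =
    ∑ f : ν → (Σ j, κ j), (∏ a, (p (f a).1 * b (f a).1 (f a).2)) *
      (Matrix.of fun b a => (U (f a).1 * L (f a).1) (f a).2 b).det ^ 2 :=
  cauchy_binet (fun k : (Σ j, κ j) => p k.1 * b k.1 k.2) (fun k => (U k.1 * L k.1) k.2)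

lemma compact_orth (κ : Type) [Fintype κ] [DecidableEq κ] :
    IsCompact {U : Matrix κ κ ℝ | U ∈ Matrix.orthogonalGroup κ ℝ} := by
  have h1 : IsCompact {U : Matrix κ κ ℝ | ∀ i, U i ∈ {v : κ → ℝ | ∀ i', v i' ∈ Set.Icc (-1:ℝ) 1}} :=
    isCompact_pi_infinite fun i => isCompact_pi_infinite fun i' => isCompact_Icc
  refine h1.of_isClosed_subset ?_ ?_
  · have : {U : Matrix κ κ ℝ | U ∈ Matrix.orthogonalGroup κ ℝ} = {U | U * star U = 1} := by
      ext U
      exact Matrix.mem_orthogonalGroup_iff κ ℝ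
    rw [this]
    refine isClosed_eq (Continuous.matrix_mul continuous_id ?_) continuous_const
    exact continuous_star
  · intro U hU i i'
    have := entry_norm_bound_of_unitary hU i i'
    rwa [Real.norm_eq_abs, abs_le] at this

theorem GB_usc (p : ι → ℝ) (hp : ∀ j, 0 ≤ p j) (L0 : ∀ j, Matrix (κ j) ν ℝ) (D : ℝ) (hD : 0 ≤ D)
    (h : GB p L0 D) (ε : ℝ) (hε : 0 < ε) (hε1 : ε < 1) :
    ∀ᶠ L in nhds L0, GB p L (D / (1 - ε)) := by
  have hK : IsCompact {U : ∀ j, Matrix (κ j) (κ j) ℝ | ∀ j, U j ∈ {V | V ∈ Matrix.orthogonalGroup (κ j) ℝ}} :=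
    isCompact_pi_infinite fun j => compact_orth (κ j)
  unfold GB
  refine hK.eventually_forall_of_forall_eventually (P := fun L U => ∀ b : ∀ j, κ j → ℝ, (∀ j i, 0 < b j i) →
      ∏ j, (∏ i, b j i) ^ p j ≤ D / (1 - ε) * (GM p L U b).det) ?_
  intro U0 hU0
  let d : (ν → (Σ j, κ j)) → ((∀ j, Matrix (κ j) ν ℝ) × (∀ j, Matrix (κ j) (κ j) ℝ)) → ℝ := fun f z =>
    (Matrix.of fun b a => (z.2 (f a).1 * z.1 (f a).1) (f a).2 b).det ^ 2
  have hd : ∀ f, Continuous (d f) := by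
    intro f
    refine Continuous.pow (Continuous.matrix_det ?_) 2
    refine continuous_matrix fun b a => ?_
    simp only [Matrix.of_apply]
    have h1 : Continuous (fun z : ((∀ j, Matrix (κ j) ν ℝ) × (∀ j, Matrix (κ j) (κ j) ℝ)) => z.2 (f a).1 * z.1 (f a).1) :=
      Continuous.matrix_mul ((continuous_apply _).comp continuous_snd) ((continuous_apply _).comp continuous_fst)
    exact h1.matrix_elem _ _
  have hev : ∀ᶠ z in nhds (L0, U0), ∀ f, (1 - ε) * d f (L0, U0) ≤ d f z := by
    rw [Filter.eventually_all]
    intro f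
    have h0 : 0 ≤ d f (L0, U0) := sq_nonneg _
    rcases h0.eq_or_lt with h0 | h0
    · exact Filter.Eventually.of_forall fun z => by rw [← h0, mul_zero]; exact sq_nonneg _
    · have : (1 - ε) * d f (L0, U0) < d f (L0, U0) := by nlinarith
      filter_upwards [(hd f).continuousAt.eventually (lt_mem_nhds this)] with z hz using hz.le
  filter_upwards [hev] with z hz b hb
  have hfac : (0:ℝ) < ((Fintype.card ν).factorial : ℝ) := by exact_mod_cast Nat.factorial_pos _
  have key : (1 - ε) * (GM p L0 U0 b).det ≤ (GM p z.1 z.2 b).det := by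
    refine le_of_mul_le_mul_left ?_ hfac
    rw [GM_det, mul_left_comm, GM_det, Finset.mul_sum]
    refine Finset.sum_le_sum fun f _ => ?_
    rw [mul_left_comm]
    exact mul_le_mul_of_nonneg_left (hz f) (Finset.prod_nonneg fun a _ => mul_nonneg (hp _) (hb _ _).le)
  refine (h U0 hU0 b hb).trans ?_
  rw [div_mul_eq_mul_div, le_div_iff₀ (by linarith)]
  nlinarith
end GB
end BLC

namespace BLC
open Matrix

lemma lintegral_mulVec {ν : Type} [Fintype ν] [DecidableEq ν] (A : Matrix ν ν ℝ) (hA : A.det ≠ 0)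
    (g : (ν → ℝ) → ℝ≥0∞) (hg : Measurable g) :
    ∫⁻ x, g (A *ᵥ x) = ENNReal.ofReal |A.det|⁻¹ * ∫⁻ x, g x := by
  have h := Real.map_matrix_volume_pi_eq_smul_volume_pi hA
  have hm : Measurable (Matrix.toLin' A) := (LinearMap.continuous_of_finiteDimensional _).measurable
  calc ∫⁻ x, g (A *ᵥ x) = ∫⁻ x, g x ∂(Measure.map (Matrix.toLin' A) volume) := by
        rw [lintegral_map hg hm]; rfl
    _ = _ := by rw [h, lintegral_smul_measure, abs_inv, smul_eq_mul]

lemma lintegral_gauss_one (ν : Type) [Fintype ν] :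
    ∫⁻ x : ν → ℝ, ENNReal.ofReal (Real.exp (-Real.pi * ∑ k, x k ^ 2)) = 1 := by
  rw [← ofReal_integral_eq_lintegral_ofReal (integrable_gauss Real.pi Real.pi_pos)
    (Filter.Eventually.of_forall fun x => (Real.exp_pos _).le), integral_gauss_one, ENNReal.ofReal_one]

lemma lintegral_gauss_mat {ν : Type} [Fintype ν] [DecidableEq ν] (A : Matrix ν ν ℝ) (hA : A.det ≠ 0) :
    ∫⁻ x : ν → ℝ, ENNReal.ofReal (Real.exp (-Real.pi * ∑ k, (A *ᵥ x) k ^ 2)) =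
      ENNReal.ofReal |A.det|⁻¹ := by
  rw [lintegral_mulVec A hA (fun x => ENNReal.ofReal (Real.exp (-Real.pi * ∑ k, x k ^ 2))) (by fun_prop),
    lintegral_gauss_one, mul_one]

section GBq
variable {ι ν : Type} {κ : ι → Type} [Fintype ι] [Fintype ν] [DecidableEq ν]
  [∀ j, Fintype (κ j)] [∀ j, DecidableEq (κ j)]

lemma GM_quad (p : ι → ℝ) (L : ∀ j, Matrix (κ j) ν ℝ) (U : ∀ j, Matrix (κ j) (κ j) ℝ)
    (b : ∀ j, κ j → ℝ) (x : ν → ℝ) :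
    x ⬝ᵥ (GM p L U b *ᵥ x) = ∑ j, p j * ∑ i, b j i * ((U j * L j) *ᵥ x) i ^ 2 := by
  have h : ∀ j, p j * ∑ i, b j i * ((U j * L j) *ᵥ x) i ^ 2
      = ∑ i, p j * (b j i * ((U j * L j) *ᵥ x) i ^ 2) := fun j => Finset.mul_sum _ _ _
  rw [Finset.sum_congr rfl fun j _ => h j, ← Fintype.sum_sigma' (fun j i => p j * (b j i * ((U j * L j) *ᵥ x) i ^ 2))]
  simp only [dotProduct, mulVec, GM, Matrix.of_apply, Finset.sum_mul, Finset.mul_sum, sq]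
  rw [Finset.sum_comm' (t' := Finset.univ) (s' := fun _ => Finset.univ) (by simp)]
  have h2 : ∀ y : ν, ∑ x_1, ∑ i : (Σ j, κ j), x x_1 * (p i.fst * b i.fst i.snd * (U i.fst * L i.fst) i.snd x_1 * (U i.fst * L i.fst) i.snd y * x y)
      = ∑ i : (Σ j, κ j), ∑ x_1, x x_1 * (p i.fst * b i.fst i.snd * (U i.fst * L i.fst) i.snd x_1 * (U i.fst * L i.fst) i.snd y * x y) := fun y => Finset.sum_comm
  rw [Finset.sum_congr rfl fun y _ => h2 y, Finset.sum_comm]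
  refine Finset.sum_congr rfl fun k _ => Finset.sum_congr rfl fun y _ => Finset.sum_congr rfl fun z _ => ?_
  ring

lemma GM_symm (p : ι → ℝ) (L : ∀ j, Matrix (κ j) ν ℝ) (U : ∀ j, Matrix (κ j) (κ j) ℝ)
    (b : ∀ j, κ j → ℝ) : (GM p L U b).IsHermitian := by
  ext x y
  simp only [conjTranspose_apply, GM, Matrix.of_apply, star_trivial]
  exact Finset.sum_congr rfl fun k _ => by ring

lemma GM_delta_posDef (p : ι → ℝ) (hp : ∀ j, 0 ≤ p j) (L : ∀ j, Matrix (κ j) ν ℝ) (U : ∀ j, Matrix (κ j) (κ j) ℝ)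
    (b : ∀ j, κ j → ℝ) (hb : ∀ j i, 0 ≤ b j i) (δ : ℝ) (hδ : 0 < δ) :
    (GM p L U b + δ • (1 : Matrix ν ν ℝ)).PosDef := by
  refine Matrix.PosDef.of_dotProduct_mulVec_pos ((GM_symm p L U b).add (isHermitian_one.smul (by simp [IsSelfAdjoint]))) ?_
  intro x hx
  rw [star_trivial, add_mulVec, dotProduct_add, GM_quad, smul_mulVec, one_mulVec, dotProduct_smul]
  have h1 : 0 < x ⬝ᵥ x := by
    have := dotProduct_star_self_pos_iff.2 hx
    simpa using this
  have h2 : 0 ≤ ∑ j, p j * ∑ i, b j i * ((U j * L j) *ᵥ x) i ^ 2 :=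
    Finset.sum_nonneg fun j _ => mul_nonneg (hp j) (Finset.sum_nonneg fun i _ => mul_nonneg (hb j i) (sq_nonneg _))
  have h3 : 0 < δ • (x ⬝ᵥ x) := mul_pos hδ h1
  linarith

open scoped MatrixOrder Matrix.Norms.L2Operator in
lemma posDef_factor {N : Matrix ν ν ℝ} (hN : N.PosDef) :
    ∃ B : Matrix ν ν ℝ, N = Bᵀ * B ∧ B.det ≠ 0 ∧ B.det ^ 2 = N.det ∧
      ∀ x, x ⬝ᵥ (N *ᵥ x) = ∑ k, (B *ᵥ x) k ^ 2 := by
  obtain ⟨B, hB⟩ := CStarAlgebra.nonneg_iff_eq_star_mul_self.mp hN.posSemidef.nonneg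
  rw [star_eq_conjTranspose, conjTranspose_eq_transpose_of_trivial] at hB
  have h2 : B.det ^ 2 = N.det := by rw [hB, det_mul, det_transpose, sq]
  refine ⟨B, hB, ?_, h2, fun x => ?_⟩
  · intro h
    have := hN.det_pos
    rw [← h2, h] at this
    simp at this
  · rw [hB, ← mulVec_mulVec, dotProduct_mulVec, vecMul_transpose]
    simp [dotProduct, sq]

lemma GB_of_bound (p : ι → ℝ) (hp : ∀ j, 0 ≤ p j) (L : ∀ j, Matrix (κ j) ν ℝ) (C : ℝ) (hC : 0 ≤ C)
    (h : ∀ f : ∀ j, (κ j → ℝ) → ℝ≥0∞, (∀ j, Measurable (f j)) → (∀ j, 0 < ∫⁻ y, f j y) →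
      (∀ j, ∫⁻ y, f j y < ⊤) →
      ∫⁻ x : ν → ℝ, ∏ j, (f j (L j *ᵥ x)) ^ (p j) ≤ ENNReal.ofReal C * ∏ j, (∫⁻ y, f j y) ^ (p j)) :
    GB p L (C ^ 2) := by
  intro U hU b hb
  let A : ∀ j, Matrix (κ j) (κ j) ℝ := fun j => diagonal (fun i => √(b j i)) * U j
  have hAdet : ∀ j, |(A j).det| = √(∏ i, b j i) := by
    intro j
    have h1 : |(U j).det| = 1 := by
      have h2 := (Matrix.mem_orthogonalGroup_iff (κ j) ℝ).1 (hU j)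
      have h3 := congrArg Matrix.det h2
      rw [det_mul, det_one, det_transpose] at h3
      rcases mul_self_eq_one_iff.1 h3 with h4 | h4 <;> simp [h4]
    rw [det_mul, abs_mul, h1, mul_one, det_diagonal, abs_of_nonneg (Finset.prod_nonneg fun i _ => Real.sqrt_nonneg _)]
    rw [Real.sqrt_prod _ fun i _ => (hb j i).le]
  have hbp : ∀ j, 0 < ∏ i, b j i := fun j => Finset.prod_pos fun i _ => hb j i
  have hA0 : ∀ j, (A j).det ≠ 0 := by
    intro j h0
    have := hAdet j
    rw [h0, abs_zero] at this
    exact (Real.sqrt_pos.2 (hbp j)).ne this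
  let f : ∀ j, (κ j → ℝ) → ℝ≥0∞ := fun j y => ENNReal.ofReal (Real.exp (-Real.pi * ∑ k, (A j *ᵥ y) k ^ 2))
  have hf : ∀ j, ∫⁻ y, f j y = ENNReal.ofReal (√(∏ i, b j i))⁻¹ := fun j => by
    rw [← hAdet j]; exact lintegral_gauss_mat (A j) (hA0 j)
  have hfm : ∀ j, Measurable (f j) := by
    intro j
    have : Continuous fun y : κ j → ℝ => A j *ᵥ y := by fun_prop
    have : ∀ k, Continuous fun y : κ j → ℝ => (A j *ᵥ y) k := fun k => (continuous_apply k).comp this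
    refine ENNReal.measurable_ofReal.comp (Continuous.measurable ?_)
    fun_prop
  have hb1 := h f hfm (fun j => by
      rw [hf]; exact ENNReal.ofReal_pos.2 (inv_pos.2 (Real.sqrt_pos.2 (hbp j))))
    (fun j => by rw [hf]; exact ENNReal.ofReal_lt_top)
  have hquad : ∀ x, ∏ j, (f j (L j *ᵥ x)) ^ (p j) =
      ENNReal.ofReal (Real.exp (-Real.pi * (x ⬝ᵥ (GM p L U b *ᵥ x)))) := by
    intro x
    rw [GM_quad, Finset.mul_sum, Real.exp_sum, ENNReal.ofReal_prod_of_nonneg fun j _ => (Real.exp_pos _).le]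
    refine Finset.prod_congr rfl fun j _ => ?_
    rw [ENNReal.ofReal_rpow_of_pos (Real.exp_pos _), ← Real.exp_mul]
    congr 2
    have : ∀ k, (A j *ᵥ (L j *ᵥ x)) k ^ 2 = b j k * ((U j * L j) *ᵥ x) k ^ 2 := by
      intro k
      have : A j *ᵥ (L j *ᵥ x) = diagonal (fun i => √(b j i)) *ᵥ ((U j * L j) *ᵥ x) := by
        simp only [A, mulVec_mulVec, Matrix.mul_assoc]
      rw [this, mulVec_diagonal, mul_pow, Real.sq_sqrt (hb j k).le]
    simp only [this]
    ring
  have key : ∀ δ : ℝ, 0 < δ → ∏ j, (∏ i, b j i) ^ p j ≤ C ^ 2 * (GM p L U b + δ • (1 : Matrix ν ν ℝ)).det := by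
    intro δ hδ
    have hN := GM_delta_posDef p hp L U b (fun j i => (hb j i).le) δ hδ
    obtain ⟨B, hB, hB0, hBd, hBq⟩ := posDef_factor hN
    have hlow : ENNReal.ofReal |B.det|⁻¹ ≤ ∫⁻ x : ν → ℝ, ∏ j, (f j (L j *ᵥ x)) ^ (p j) := by
      rw [← lintegral_gauss_mat B hB0]
      refine lintegral_mono fun x => ?_
      rw [hquad]
      refine ENNReal.ofReal_le_ofReal (Real.exp_le_exp.2 ?_)
      rw [← hBq x, add_mulVec, dotProduct_add, smul_mulVec, one_mulVec, dotProduct_smul]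
      have : 0 ≤ δ • (x ⬝ᵥ x) := by
        refine mul_nonneg hδ.le ?_
        simpa using dotProduct_star_self_nonneg x
      nlinarith [Real.pi_pos]
    have h2 := hlow.trans hb1
    have h3 : ∏ j, (∫⁻ y, f j y) ^ (p j) = ENNReal.ofReal (√(∏ j, (∏ i, b j i) ^ p j))⁻¹ := by
      rw [Real.sqrt_prod _ fun j _ => Real.rpow_nonneg (hbp j).le _, ← Finset.prod_inv_distrib,
        ENNReal.ofReal_prod_of_nonneg fun j _ => inv_nonneg.2 (Real.sqrt_nonneg _)]
      refine Finset.prod_congr rfl fun j _ => ?_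
      rw [hf, ENNReal.ofReal_rpow_of_pos (inv_pos.2 (Real.sqrt_pos.2 (hbp j)))]
      congr 1
      rw [Real.inv_rpow (Real.sqrt_nonneg _), Real.sqrt_eq_rpow, Real.sqrt_eq_rpow,
        ← Real.rpow_mul (hbp j).le, ← Real.rpow_mul (hbp j).le, mul_comm]
    rw [h3, ← ENNReal.ofReal_mul hC, ENNReal.ofReal_le_ofReal_iff (by positivity)] at h2
    have hP : 0 < ∏ j, (∏ i, b j i) ^ p j := Finset.prod_pos fun j _ => Real.rpow_pos_of_pos (hbp j) _
    have hBa : 0 < |B.det| := abs_pos.2 hB0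
    rw [← div_eq_mul_inv, inv_eq_one_div, div_le_div_iff₀ hBa (Real.sqrt_pos.2 hP), one_mul] at h2
    rw [← hBd, ← sq_abs B.det, ← mul_pow]
    exact (Real.sqrt_le_left (by positivity)).1 h2
  have hcont : Continuous fun δ : ℝ => C ^ 2 * (GM p L U b + δ • (1 : Matrix ν ν ℝ)).det :=
    continuous_const.mul (Continuous.matrix_det (by fun_prop))
  have hlim : Filter.Tendsto (fun δ : ℝ => C ^ 2 * (GM p L U b + δ • (1 : Matrix ν ν ℝ)).det)
      (nhdsWithin 0 (Set.Ioi 0)) (nhds (C ^ 2 * (GM p L U b).det)) := by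
    have := (hcont.tendsto 0).mono_left (nhdsWithin_le_nhds (s := Set.Ioi 0))
    simpa using this
  exact ge_of_tendsto hlim (eventually_nhdsWithin_of_forall fun δ hδ => key δ hδ)

end GBq
end BLC

namespace BLC
open Matrix

section Q
variable {κ : Type} [Fintype κ] [DecidableEq κ]

/-- symmetric matrices `0 ≤ A ≤ K` -/
def Qset (κ : Type) [Fintype κ] (K : ℝ) : Set (Matrix κ κ ℝ) :=
  {A | Aᵀ = A ∧ ∀ x : κ → ℝ, 0 ≤ x ⬝ᵥ (A *ᵥ x) ∧ x ⬝ᵥ (A *ᵥ x) ≤ K * (x ⬝ᵥ x)}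

lemma quad_polar (A : Matrix κ κ ℝ) (hA : Aᵀ = A) (i j : κ) :
    4 * A i j = (Pi.single i 1 + Pi.single j 1) ⬝ᵥ (A *ᵥ (Pi.single i 1 + Pi.single j 1))
      - (Pi.single i 1 - Pi.single j 1) ⬝ᵥ (A *ᵥ (Pi.single i 1 - Pi.single j 1)) := by
  have h : A j i = A i j := congrFun (congrFun hA i) j
  simp only [mulVec_add, mulVec_sub, dotProduct_add, dotProduct_sub, add_dotProduct, sub_dotProduct,
    mulVec_single_one, single_one_dotProduct, Matrix.col_apply]
  rw [h]; ring

lemma compact_Qset (K : ℝ) : IsCompact (Qset κ K) := by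
  let e : κ → κ → ℝ := fun i j => K * ((Pi.single i 1 + Pi.single j 1) ⬝ᵥ (Pi.single i 1 + Pi.single j 1))
      + K * ((Pi.single i 1 - Pi.single j 1) ⬝ᵥ (Pi.single i 1 - Pi.single j 1))
  have h1 : IsCompact {U : Matrix κ κ ℝ | ∀ i, U i ∈ {v : κ → ℝ | ∀ i', v i' ∈ Set.Icc (-(e i i')) (e i i')}} :=
    isCompact_pi_infinite fun i => isCompact_pi_infinite fun i' => isCompact_Icc
  refine h1.of_isClosed_subset ?_ ?_
  · have : Qset κ K = {A | Aᵀ = A} ∩ ⋂ x : κ → ℝ, ({A | 0 ≤ x ⬝ᵥ (A *ᵥ x)} ∩ {A | x ⬝ᵥ (A *ᵥ x) ≤ K * (x ⬝ᵥ x)}) := by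
      ext A; simp [Qset]
    rw [this]
    have hc : ∀ x : κ → ℝ, Continuous fun A : Matrix κ κ ℝ => x ⬝ᵥ (A *ᵥ x) := fun x => by fun_prop
    refine IsClosed.inter (isClosed_eq (by fun_prop) continuous_id) (isClosed_iInter fun x => IsClosed.inter ?_ ?_)
    · exact isClosed_le continuous_const (hc x)
    · exact isClosed_le (hc x) continuous_const
  · intro A hA i j
    have h2 := quad_polar A hA.1 i j
    have h3 := hA.2 (Pi.single i 1 + Pi.single j 1)
    have h4 := hA.2 (Pi.single i 1 - Pi.single j 1)
    have h5 := h3.1.trans h3.2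
    have h6 := h4.1.trans h4.2
    simp only [e, Set.mem_Icc]
    constructor <;> linarith [h3.1, h3.2, h4.1, h4.2]

lemma orth_mul {U : Matrix κ κ ℝ} (hU : U ∈ Matrix.orthogonalGroup κ ℝ) : U * Uᵀ = 1 :=
  (Matrix.mem_orthogonalGroup_iff κ ℝ).1 hU
lemma orth_mul' {U : Matrix κ κ ℝ} (hU : U ∈ Matrix.orthogonalGroup κ ℝ) : Uᵀ * U = 1 :=
  (Matrix.mem_orthogonalGroup_iff' κ ℝ).1 hU

lemma diag_of_Qset {K : ℝ} {A : Matrix κ κ ℝ} (hA : A ∈ Qset κ K) :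
    ∃ U ∈ Matrix.orthogonalGroup κ ℝ, ∃ b : κ → ℝ, (∀ i, 0 ≤ b i ∧ b i ≤ K) ∧
      A = Uᵀ * diagonal b * U := by
  have hH : A.IsHermitian := by
    rw [IsHermitian, conjTranspose_eq_transpose_of_trivial]; exact hA.1
  let V : Matrix κ κ ℝ := (hH.eigenvectorUnitary : Matrix κ κ ℝ)
  have hV : V ∈ Matrix.orthogonalGroup κ ℝ := hH.eigenvectorUnitary.2
  have hsp : A = V * diagonal hH.eigenvalues * Vᵀ := by
    have := hH.spectral_theorem
    rw [Unitary.conjStarAlgAut_apply] at this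
    exact this
  have hq : ∀ i, hH.eigenvalues i = (V *ᵥ Pi.single i 1) ⬝ᵥ (A *ᵥ (V *ᵥ Pi.single i 1)) := by
    intro i
    have e0 : (V *ᵥ Pi.single i 1) ⬝ᵥ (A *ᵥ (V *ᵥ Pi.single i 1))
        = Pi.single i 1 ⬝ᵥ ((Vᵀ * (A * V)) *ᵥ Pi.single i 1) := by
      rw [← mulVec_mulVec, ← mulVec_mulVec, dotProduct_mulVec (Pi.single i 1), vecMul_transpose]
    rw [e0]
    have : Vᵀ * (A * V) = diagonal hH.eigenvalues := by
      have e1 : A * V = V * diagonal hH.eigenvalues := by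
        conv_lhs => rw [hsp]
        rw [Matrix.mul_assoc, orth_mul' hV, Matrix.mul_one]
      rw [e1, ← Matrix.mul_assoc, orth_mul' hV, Matrix.one_mul]
    rw [this]
    simp
  have hn : ∀ i, (V *ᵥ Pi.single i 1) ⬝ᵥ (V *ᵥ Pi.single i (1:ℝ)) = 1 := by
    intro i
    rw [dotProduct_mulVec, ← mulVec_transpose, mulVec_mulVec, orth_mul' hV]
    simp
  refine ⟨Vᵀ, ?_, hH.eigenvalues, fun i => ?_, by rw [transpose_transpose]; exact hsp⟩
  · rw [Matrix.mem_orthogonalGroup_iff, transpose_transpose]; exact orth_mul' hV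
  · have := hA.2 (V *ᵥ Pi.single i 1)
    rw [hn, mul_one, ← hq] at this
    exact this

lemma det_rank_one (B R : Matrix κ κ ℝ) (hR : R * B = 1) (v : κ → ℝ) (t : ℝ) :
    (Bᵀ * B + t • vecMulVec v v).det = (Bᵀ * B).det * (1 + t * ∑ k, (Rᵀ *ᵥ v) k ^ 2) := by
  have hv : v = Bᵀ *ᵥ (Rᵀ *ᵥ v) := by
    rw [mulVec_mulVec, ← transpose_mul, hR, transpose_one, one_mulVec]
  have h1 : Bᵀ * B + t • vecMulVec v v =
      Bᵀ * (1 + replicateCol Unit (t • (Rᵀ *ᵥ v)) * replicateRow Unit (Rᵀ *ᵥ v)) * B := by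
    have h2 : replicateCol Unit (t • (Rᵀ *ᵥ v)) * replicateRow Unit (Rᵀ *ᵥ v) = t • vecMulVec (Rᵀ *ᵥ v) (Rᵀ *ᵥ v) := by
      rw [← vecMulVec_eq, smul_vecMulVec]
    rw [h2, Matrix.mul_add, Matrix.add_mul, Matrix.mul_one, Matrix.mul_smul, Matrix.smul_mul]
    rw [mul_vecMulVec, vecMulVec_mul, ← mulVec_transpose, ← hv]
  rw [h1, det_mul, det_mul, det_one_add_replicateCol_mul_replicateRow, det_mul]
  have : (Rᵀ *ᵥ v) ⬝ᵥ (t • (Rᵀ *ᵥ v)) = t * ∑ k, (Rᵀ *ᵥ v) k ^ 2 := by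
    rw [dotProduct_smul, smul_eq_mul]; simp [dotProduct, sq]
  rw [this]; ring

/-- first-order optimality -/
lemma first_order {p α β : ℝ} (hp : 0 < p)
    (h : ∀ᶠ s in nhdsWithin (0:ℝ) (Set.Ioi 0), (1 - s * α) ^ p ≤ 1 - s * (p * β)) : β ≤ α := by
  have hd : HasDerivAt (fun s : ℝ => (1 - s * α) ^ p - (1 - s * (p * β))) (-(p * α) + p * β) 0 := by
    have h1 : HasDerivAt (fun s : ℝ => 1 - s * α) (-α) 0 := by
      simpa using ((hasDerivAt_id (0:ℝ)).mul_const α).const_sub 1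
    have h2 : HasDerivAt (fun s : ℝ => 1 - s * (p * β)) (-(p * β)) 0 := by
      simpa using ((hasDerivAt_id (0:ℝ)).mul_const (p * β)).const_sub 1
    have h3 := h1.rpow_const (p := p) (Or.inl (by simp))
    refine (h3.sub h2).congr_deriv ?_
    simp; ring
  have hs := (hasDerivAt_iff_tendsto_slope.1 hd).mono_left
    (nhdsWithin_mono (0:ℝ) (s := Set.Ioi 0) (fun x hx => ne_of_gt (Set.mem_Ioi.1 hx)))
  have : -(p * α) + p * β ≤ 0 := by
    refine le_of_tendsto hs ?_
    filter_upwards [h, self_mem_nhdsWithin] with s hs hs0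
    rw [slope_def_field]
    simp only [zero_mul, sub_zero, Real.one_rpow, sub_self]
    exact div_nonpos_of_nonpos_of_nonneg (by linarith) (le_of_lt hs0)
  nlinarith
end Q

section Max
variable {ι ν : Type} {κ : ι → Type} [Fintype ι] [DecidableEq ι] [Fintype ν] [DecidableEq ν]
  [∀ j, Fintype (κ j)] [∀ j, DecidableEq (κ j)]

noncomputable def MM (p : ι → ℝ) (L : ∀ j, Matrix (κ j) ν ℝ) (δ : ℝ) (A : ∀ j, Matrix (κ j) (κ j) ℝ) :
    Matrix ν ν ℝ := δ • (1 : Matrix ν ν ℝ) + ∑ j, p j • ((L j)ᵀ * A j * L j)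

lemma MM_quad (p : ι → ℝ) (L : ∀ j, Matrix (κ j) ν ℝ) (δ : ℝ) (A : ∀ j, Matrix (κ j) (κ j) ℝ) (x : ν → ℝ) :
    x ⬝ᵥ (MM p L δ A *ᵥ x) = δ * (x ⬝ᵥ x) + ∑ j, p j * ((L j *ᵥ x) ⬝ᵥ (A j *ᵥ (L j *ᵥ x))) := by
  rw [MM, add_mulVec, dotProduct_add, smul_mulVec, one_mulVec, dotProduct_smul, sum_mulVec, dotProduct_sum]
  congr 1
  refine Finset.sum_congr rfl fun j _ => ?_
  rw [smul_mulVec, dotProduct_smul, Matrix.mul_assoc, ← mulVec_mulVec, ← mulVec_mulVec, dotProduct_mulVec,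
    vecMul_transpose]
  rfl

lemma MM_posDef (p : ι → ℝ) (hp : ∀ j, 0 ≤ p j) (L : ∀ j, Matrix (κ j) ν ℝ) {δ : ℝ} (hδ : 0 < δ) {K : ℝ}
    {A : ∀ j, Matrix (κ j) (κ j) ℝ} (hA : ∀ j, A j ∈ Qset (κ j) K) : (MM p L δ A).PosDef := by
  refine Matrix.PosDef.of_dotProduct_mulVec_pos ?_ ?_
  · rw [IsHermitian, conjTranspose_eq_transpose_of_trivial, MM, transpose_add, transpose_smul, transpose_one,
      transpose_sum]
    congr 1
    refine Finset.sum_congr rfl fun j _ => ?_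
    rw [transpose_smul, transpose_mul, transpose_mul, transpose_transpose, (hA j).1, Matrix.mul_assoc]
  · intro x hx
    rw [star_trivial, MM_quad]
    have h1 : 0 < x ⬝ᵥ x := by
      have := dotProduct_star_self_pos_iff.2 hx
      simpa using this
    have h2 : 0 ≤ ∑ j, p j * ((L j *ᵥ x) ⬝ᵥ (A j *ᵥ (L j *ᵥ x))) :=
      Finset.sum_nonneg fun j _ => mul_nonneg (hp j) ((hA j).2 _).1
    have := mul_pos hδ h1
    linarith

lemma smul_one_mem_Qset {κ : Type} [Fintype κ] [DecidableEq κ] {K : ℝ} (hK : 0 < K) :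
    K • (1 : Matrix κ κ ℝ) ∈ Qset κ K := by
  refine ⟨by rw [transpose_smul, transpose_one], fun x => ?_⟩
  rw [smul_mulVec, one_mulVec, dotProduct_smul, smul_eq_mul]
  refine ⟨mul_nonneg hK.le ?_, le_rfl⟩
  simpa using dotProduct_star_self_nonneg x

lemma Qset_det_nonneg {κ : Type} [Fintype κ] [DecidableEq κ] {K : ℝ} {A : Matrix κ κ ℝ}
    (hA : A ∈ Qset κ K) : 0 ≤ A.det := by
  obtain ⟨U, hU, b, hb, rfl⟩ := diag_of_Qset hA
  rw [det_mul_right_comm, orth_mul' hU, Matrix.one_mul, det_diagonal]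
  exact Finset.prod_nonneg fun i _ => (hb i).1

/-- the functional to maximise -/
noncomputable def Psi (p : ι → ℝ) (L : ∀ j, Matrix (κ j) ν ℝ) (δ : ℝ) (A : ∀ j, Matrix (κ j) (κ j) ℝ) : ℝ :=
  (∏ j, (A j).det ^ p j) / (MM p L δ A).det

lemma exists_max (p : ι → ℝ) (hp : ∀ j, 0 ≤ p j) (L : ∀ j, Matrix (κ j) ν ℝ) {δ : ℝ} (hδ : 0 < δ)
    {K : ℝ} (hK : 0 < K) : ∃ A : ∀ j, Matrix (κ j) (κ j) ℝ, (∀ j, A j ∈ Qset (κ j) K) ∧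
      (∀ j, 0 < (A j).det) ∧
      ∀ A' : ∀ j, Matrix (κ j) (κ j) ℝ, (∀ j, A' j ∈ Qset (κ j) K) → Psi p L δ A' ≤ Psi p L δ A := by
  have hKc : IsCompact {A : ∀ j, Matrix (κ j) (κ j) ℝ | ∀ j, A j ∈ Qset (κ j) K} :=
    isCompact_pi_infinite fun j => compact_Qset K
  have hdetK : ∀ j, 0 < (K • (1 : Matrix (κ j) (κ j) ℝ)).det := fun j => by
    rw [det_smul, det_one, mul_one]; positivity
  have hcont : ContinuousOn (Psi p L δ) {A : ∀ j, Matrix (κ j) (κ j) ℝ | ∀ j, A j ∈ Qset (κ j) K} := by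
    refine ContinuousOn.div ?_ ?_ fun A hA => (MM_posDef p hp L hδ hA).det_pos.ne'
    · refine Continuous.continuousOn (continuous_finsetProd _ fun j _ => ?_)
      exact (Real.continuous_rpow_const (hp j)).comp ((continuous_apply j).matrix_det)
    · refine Continuous.continuousOn (Continuous.matrix_det ?_)
      unfold MM
      fun_prop
  obtain ⟨A, hA, hmax⟩ := hKc.exists_isMaxOn ⟨fun j => K • 1, fun j => smul_one_mem_Qset hK⟩ hcont
  have hpos : 0 < Psi p L δ A := by
    refine lt_of_lt_of_le ?_ (hmax (fun j => smul_one_mem_Qset hK : ∀ j, K • (1 : Matrix (κ j) (κ j) ℝ) ∈ Qset (κ j) K))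
    refine div_pos (Finset.prod_pos fun j _ => Real.rpow_pos_of_pos (hdetK j) _) ?_
    exact (MM_posDef p hp L hδ (fun j => smul_one_mem_Qset hK)).det_pos
  have hdet : ∀ j, 0 < p j → 0 < (A j).det := by
    intro j hj
    refine lt_of_le_of_ne (Qset_det_nonneg (hA j)) fun h0 => ?_
    have : Psi p L δ A = 0 := by
      rw [Psi, Finset.prod_eq_zero (Finset.mem_univ j), zero_div]
      rw [← h0, Real.zero_rpow hj.ne']
    linarith
  refine ⟨fun j => if p j = 0 then K • 1 else A j, fun j => ?_, fun j => ?_, fun A' hA' => ?_⟩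
  · dsimp only; split_ifs
    · exact smul_one_mem_Qset hK
    · exact hA j
  · dsimp only; split_ifs with h
    · exact hdetK j
    · exact hdet j (lt_of_le_of_ne (hp j) (Ne.symm h))
  · refine (hmax hA').trans (le_of_eq ?_)
    unfold Psi MM
    congr 1
    · refine Finset.prod_congr rfl fun j _ => ?_
      dsimp only
      split_ifs with h
      · rw [h, Real.rpow_zero, Real.rpow_zero]
      · rfl
    · congr 2
      refine Finset.sum_congr rfl fun j _ => ?_
      dsimp only
      split_ifs with h
      · rw [h, zero_smul, zero_smul]
      · rfl
end Max
end BLC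

namespace BLC
open Matrix

section Opt
variable {ι ν : Type} {κ : ι → Type} [Fintype ι] [DecidableEq ι] [Fintype ν] [DecidableEq ν]
  [∀ j, Fintype (κ j)] [∀ j, DecidableEq (κ j)]

/-- the factor `√b U` of `Uᵀ b U` -/
noncomputable def Bf {κ : Type} [Fintype κ] [DecidableEq κ] (U : Matrix κ κ ℝ) (b : κ → ℝ) : Matrix κ κ ℝ :=
  diagonal (fun i => √(b i)) * U

lemma Bf_mul {κ : Type} [Fintype κ] [DecidableEq κ] (U : Matrix κ κ ℝ) {b : κ → ℝ} (hb : ∀ i, 0 ≤ b i) :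
    (Bf U b)ᵀ * Bf U b = Uᵀ * diagonal b * U := by
  unfold Bf
  rw [transpose_mul, diagonal_transpose, Matrix.mul_assoc, ← Matrix.mul_assoc (diagonal _), diagonal_mul_diagonal,
    Matrix.mul_assoc]
  congr 3
  funext i
  exact Real.mul_self_sqrt (hb i)

lemma Bf_mulVec {κ : Type} [Fintype κ] [DecidableEq κ] (U : Matrix κ κ ℝ) (b : κ → ℝ) (x : κ → ℝ) (i : κ) :
    (Bf U b *ᵥ x) i = √(b i) * (U *ᵥ x) i := by
  unfold Bf
  rw [← mulVec_mulVec, mulVec_diagonal]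

lemma orth_sq {κ : Type} [Fintype κ] [DecidableEq κ] {U : Matrix κ κ ℝ} (hU : U ∈ Matrix.orthogonalGroup κ ℝ)
    (x : κ → ℝ) : ∑ i, (U *ᵥ x) i ^ 2 = ∑ i, x i ^ 2 := by
  have h : (U *ᵥ x) ⬝ᵥ (U *ᵥ x) = x ⬝ᵥ x := by
    rw [dotProduct_mulVec, ← mulVec_transpose, mulVec_mulVec, orth_mul' hU, one_mulVec]
  simpa [dotProduct, sq] using h

lemma quad_factor {κ : Type} [Fintype κ] [DecidableEq κ] (B : Matrix κ κ ℝ) (x : κ → ℝ) :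
    x ⬝ᵥ ((Bᵀ * B) *ᵥ x) = ∑ k, (B *ᵥ x) k ^ 2 := by
  rw [← mulVec_mulVec, dotProduct_mulVec, vecMul_transpose]
  simp [dotProduct, sq]

lemma quad_rank_one {κ : Type} [Fintype κ] [DecidableEq κ] (z : κ → ℝ) (t : ℝ) (x : κ → ℝ) :
    x ⬝ᵥ ((t • vecMulVec z z) *ᵥ x) = t * (z ⬝ᵥ x) ^ 2 := by
  rw [smul_mulVec, dotProduct_smul, vecMulVec_mulVec, smul_eq_mul]
  simp only [dotProduct_smul, op_smul_eq_smul, smul_eq_mul]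
  rw [dotProduct_comm x z]; ring

lemma pert (p : ι → ℝ) (hp : ∀ j, 0 ≤ p j) (L : ∀ j, Matrix (κ j) ν ℝ) {δ : ℝ} (hδ : 0 < δ)
    {K : ℝ} {A : ∀ j, Matrix (κ j) (κ j) ℝ} (hA : ∀ j, A j ∈ Qset (κ j) K)
    (hdet : ∀ j, 0 < (A j).det)
    (hmax : ∀ A' : ∀ j, Matrix (κ j) (κ j) ℝ, (∀ j, A' j ∈ Qset (κ j) K) → Psi p L δ A' ≤ Psi p L δ A)
    {B R : Matrix ν ν ℝ} (hB : MM p L δ A = Bᵀ * B) (hR : R * B = 1) (j : ι)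
    {Bj Rj : Matrix (κ j) (κ j) ℝ} (hBj : A j = Bjᵀ * Bj) (hRj : Rj * Bj = 1) (z : κ j → ℝ) (t : ℝ)
    (hz : A j + t • vecMulVec z z ∈ Qset (κ j) K) :
    (1 + t * ∑ i, (Rjᵀ *ᵥ z) i ^ 2) ^ p j ≤ 1 + t * (p j * ∑ k, (Rᵀ *ᵥ ((L j)ᵀ *ᵥ z)) k ^ 2) := by
  set α := ∑ i, (Rjᵀ *ᵥ z) i ^ 2 with hα
  set β := ∑ k, (Rᵀ *ᵥ ((L j)ᵀ *ᵥ z)) k ^ 2 with hβ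
  set A' := Function.update A j (A j + t • vecMulVec z z) with hA'
  have hA'Q : ∀ j', A' j' ∈ Qset (κ j') K := by
    intro j'
    by_cases h : j' = j
    · subst h; rw [hA', Function.update_self]; exact hz
    · rw [hA', Function.update_of_ne h]; exact hA j'
  have hdj : (A j + t • vecMulVec z z).det = (A j).det * (1 + t * α) := by
    rw [hBj]; exact det_rank_one Bj Rj hRj z t
  have hα0 : 0 ≤ 1 + t * α := by
    have h1 := Qset_det_nonneg hz
    rw [hdj] at h1
    exact nonneg_of_mul_nonneg_right h1 (hdet j)
  have hprod : ∏ j', (A' j').det ^ p j' = (∏ j', (A j').det ^ p j') * (1 + t * α) ^ p j := by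
    have : (1 + t * α) ^ p j = ∏ j', if j' = j then (1 + t * α) ^ p j else 1 := by simp
    rw [this, ← Finset.prod_mul_distrib]
    refine Finset.prod_congr rfl fun j' _ => ?_
    by_cases h : j' = j
    · subst h
      rw [hA', Function.update_self, if_pos rfl, hdj, Real.mul_rpow (hdet _).le hα0]
    · rw [hA', Function.update_of_ne h, if_neg h, mul_one]
  have hMM : MM p L δ A' = Bᵀ * B + (t * p j) • vecMulVec ((L j)ᵀ *ᵥ z) ((L j)ᵀ *ᵥ z) := by
    rw [← hB]
    unfold MM
    rw [add_assoc]
    congr 1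
    have : (t * p j) • vecMulVec ((L j)ᵀ *ᵥ z) ((L j)ᵀ *ᵥ z)
        = ∑ j', if j' = j then (t * p j) • vecMulVec ((L j)ᵀ *ᵥ z) ((L j)ᵀ *ᵥ z) else 0 := by simp
    rw [this, ← Finset.sum_add_distrib]
    refine Finset.sum_congr rfl fun j' _ => ?_
    by_cases h : j' = j
    · subst h
      rw [hA', Function.update_self, if_pos rfl, Matrix.mul_add, Matrix.add_mul, smul_add]
      congr 1
      rw [Matrix.mul_smul, Matrix.smul_mul, mul_vecMulVec, vecMulVec_mul, ← mulVec_transpose, smul_smul, mul_comm]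
    · rw [hA', Function.update_of_ne h, if_neg h, add_zero]
  have hdM : (MM p L δ A').det = (MM p L δ A).det * (1 + t * (p j * β)) := by
    rw [hMM, det_rank_one B R hR, hB, mul_assoc t]
  have hM := (MM_posDef p hp L hδ hA).det_pos
  have hM' := (MM_posDef p hp L hδ hA'Q).det_pos
  have hP : 0 < ∏ j', (A j').det ^ p j' := Finset.prod_pos fun j' _ => Real.rpow_pos_of_pos (hdet j') _
  have h := hmax A' hA'Q
  unfold Psi at h
  rw [hprod, div_le_div_iff₀ hM' hM, hdM] at h
  have h2 : ((∏ j', (A j').det ^ p j') * (MM p L δ A).det) * (1 + t * α) ^ p j ≤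
    ((∏ j', (A j').det ^ p j') * (MM p L δ A).det) * (1 + t * (p j * β)) := by linarith
  exact le_of_mul_le_mul_left h2 (mul_pos hP hM)

lemma mem_minus {κ : Type} [Fintype κ] [DecidableEq κ] {K : ℝ} {A B : Matrix κ κ ℝ} (hA : A ∈ Qset κ K)
    (hB : A = Bᵀ * B) (ξ : κ → ℝ) {s : ℝ} (hs : 0 ≤ s) (hs1 : s * ∑ i, ξ i ^ 2 ≤ 1) :
    A + (-s) • vecMulVec (Bᵀ *ᵥ ξ) (Bᵀ *ᵥ ξ) ∈ Qset κ K := by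
  refine ⟨by rw [transpose_add, hA.1, transpose_smul, transpose_vecMulVec], fun x => ?_⟩
  rw [add_mulVec, dotProduct_add, quad_rank_one]
  have h1 : x ⬝ᵥ (A *ᵥ x) = ∑ k, (B *ᵥ x) k ^ 2 := by rw [hB]; exact quad_factor B x
  have h2 : ((Bᵀ *ᵥ ξ) ⬝ᵥ x) ^ 2 ≤ (∑ i, ξ i ^ 2) * ∑ k, (B *ᵥ x) k ^ 2 := by
    rw [mulVec_transpose, ← dotProduct_mulVec]
    exact Finset.sum_mul_sq_le_sq_mul_sq _ _ _
  have h3 : 0 ≤ ∑ k, (B *ᵥ x) k ^ 2 := Finset.sum_nonneg fun k _ => sq_nonneg _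
  have h4 := mul_le_mul_of_nonneg_left h2 hs
  have h5 := mul_le_mul_of_nonneg_right hs1 h3
  constructor
  · rw [h1]; nlinarith
  · have := (hA.2 x).2
    nlinarith [mul_nonneg hs (sq_nonneg ((Bᵀ *ᵥ ξ) ⬝ᵥ x))]

lemma mem_plus {κ : Type} [Fintype κ] [DecidableEq κ] {K : ℝ} {U : Matrix κ κ ℝ}
    (hU : U ∈ Matrix.orthogonalGroup κ ℝ) {b : κ → ℝ} (hb : ∀ i, 0 ≤ b i ∧ b i ≤ K)
    (hA : Uᵀ * diagonal b * U ∈ Qset κ K)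
    (i : κ) {s : ℝ} (hs : 0 ≤ s) (hs1 : b i * (1 + s) ≤ K) :
    Uᵀ * diagonal b * U + s • vecMulVec ((Bf U b)ᵀ *ᵥ Pi.single i 1) ((Bf U b)ᵀ *ᵥ Pi.single i 1) ∈ Qset κ K := by
  refine ⟨by rw [transpose_add, hA.1, transpose_smul, transpose_vecMulVec], fun x => ?_⟩
  rw [add_mulVec, dotProduct_add, quad_rank_one]
  have h0 := (hA.2 x).1
  refine ⟨add_nonneg h0 (mul_nonneg hs (sq_nonneg _)), ?_⟩
  have h1 : x ⬝ᵥ ((Uᵀ * diagonal b * U) *ᵥ x) = ∑ k, (Bf U b *ᵥ x) k ^ 2 := by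
    rw [← Bf_mul U fun i => (hb i).1]; exact quad_factor _ x
  have h2 : ((Bf U b)ᵀ *ᵥ Pi.single i 1) ⬝ᵥ x = (Bf U b *ᵥ x) i := by
    rw [mulVec_transpose, ← dotProduct_mulVec, single_one_dotProduct]
  rw [h1, h2]
  have h3 : x ⬝ᵥ x = ∑ k, (U *ᵥ x) k ^ 2 := by rw [orth_sq hU]; simp [dotProduct, sq]
  rw [h3, Finset.mul_sum]
  simp only [Bf_mulVec, mul_pow, Real.sq_sqrt (hb _).1]
  have h4 : s * (b i * (U *ᵥ x) i ^ 2) = ∑ k, if k = i then s * (b i * (U *ᵥ x) i ^ 2) else 0 := by simp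
  rw [h4, ← Finset.sum_add_distrib]
  refine Finset.sum_le_sum fun k _ => ?_
  have h5 := sq_nonneg ((U *ᵥ x) k)
  split_ifs with h
  · subst h; nlinarith
  · have := (hb k).2; nlinarith

theorem opt_exists (p : ι → ℝ) (hp : ∀ j, 0 ≤ p j) (L : ∀ j, Matrix (κ j) ν ℝ) {δ : ℝ} (hδ : 0 < δ)
    {K : ℝ} (hK : 0 < K) :
    ∃ (U : ∀ j, Matrix (κ j) (κ j) ℝ) (b : ∀ j, κ j → ℝ) (R : Matrix ν ν ℝ),
      (∀ j, U j ∈ Matrix.orthogonalGroup (κ j) ℝ) ∧ (∀ j i, 0 < b j i ∧ b j i ≤ K) ∧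
      R.det ≠ 0 ∧ Rᵀ * MM p L δ (fun j => (U j)ᵀ * diagonal (b j) * U j) * R = 1 ∧
      (∀ j, 0 < p j → ∀ ξ : κ j → ℝ,
        ∑ k, (∑ i, ξ i * (Bf (U j) (b j) * L j * R) i k) ^ 2 ≤ ∑ i, ξ i ^ 2) ∧
      (∀ j, 0 < p j → ∀ i, b j i = K ∨ ∑ k, (Bf (U j) (b j) * L j * R) i k ^ 2 = 1) := by
  obtain ⟨A, hA, hdet, hmax⟩ := exists_max p hp L hδ hK
  choose U hU b hb hAU using fun j => diag_of_Qset (hA j)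
  have hbpos : ∀ j i, 0 < b j i := by
    intro j i
    refine lt_of_le_of_ne (hb j i).1 fun h0 => ?_
    have h1 := hdet j
    rw [hAU j, det_mul_right_comm, orth_mul' (hU j), Matrix.one_mul, det_diagonal,
      Finset.prod_eq_zero (Finset.mem_univ i) h0.symm] at h1
    exact lt_irrefl _ h1
  obtain ⟨B, hB, hB0, -, -⟩ := posDef_factor (MM_posDef p hp L hδ hA)
  have hBu : IsUnit B.det := isUnit_iff_ne_zero.2 hB0
  have hBB := nonsing_inv_mul B hBu
  have hBB' := mul_nonsing_inv B hBu
  let Rj : ∀ j, Matrix (κ j) (κ j) ℝ := fun j => (U j)ᵀ * diagonal (fun i => (√(b j i))⁻¹)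
  have hRj : ∀ j, Rj j * Bf (U j) (b j) = 1 := by
    intro j
    simp only [Rj, Bf]
    rw [Matrix.mul_assoc, ← Matrix.mul_assoc (diagonal _), diagonal_mul_diagonal]
    have : (fun i => (√(b j i))⁻¹ * √(b j i)) = fun _ => 1 := by
      funext i; exact inv_mul_cancel₀ (Real.sqrt_pos.2 (hbpos j i)).ne'
    rw [this, diagonal_one, Matrix.one_mul, orth_mul' (hU j)]
  have hBj : ∀ j, A j = (Bf (U j) (b j))ᵀ * Bf (U j) (b j) := fun j => by
    rw [Bf_mul _ fun i => (hb j i).1]; exact hAU j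
  have hRξ : ∀ j (ξ : κ j → ℝ), (Rj j)ᵀ *ᵥ ((Bf (U j) (b j))ᵀ *ᵥ ξ) = ξ := by
    intro j ξ
    have : Bf (U j) (b j) * Rj j = 1 := mul_eq_one_comm.1 (hRj j)
    rw [mulVec_mulVec, ← transpose_mul, this, transpose_one, one_mulVec]
  have hLξ : ∀ j (ξ : κ j → ℝ), (B⁻¹)ᵀ *ᵥ ((L j)ᵀ *ᵥ ((Bf (U j) (b j))ᵀ *ᵥ ξ))
      = fun k => ∑ i, ξ i * (Bf (U j) (b j) * L j * B⁻¹) i k := by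
    intro j ξ
    rw [mulVec_mulVec, mulVec_mulVec, ← transpose_mul, ← transpose_mul, ← Matrix.mul_assoc, mulVec_transpose]
    rfl
  have hi : ∀ j, 0 < p j → ∀ ξ : κ j → ℝ,
        ∑ k, (∑ i, ξ i * (Bf (U j) (b j) * L j * B⁻¹) i k) ^ 2 ≤ ∑ i, ξ i ^ 2 := by
    intro j hj ξ
    refine first_order hj ?_
    have hS : 0 ≤ ∑ i, ξ i ^ 2 := Finset.sum_nonneg fun i _ => sq_nonneg _
    have hev : ∀ᶠ s in nhdsWithin (0:ℝ) (Set.Ioi 0), s < (1 + ∑ i, ξ i ^ 2)⁻¹ :=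
      (nhdsWithin_le_nhds) (gt_mem_nhds (inv_pos.2 (by linarith)))
    filter_upwards [hev, self_mem_nhdsWithin] with s hs hs0
    have hs0' : 0 < s := hs0
    have hs1 : s * ∑ i, ξ i ^ 2 ≤ 1 := by
      have h1 : s * (1 + ∑ i, ξ i ^ 2) < 1 := by
        rwa [← lt_inv_mul_iff₀' (by linarith), mul_one] 
      nlinarith
    have := pert p hp L hδ hA hdet hmax hB hBB j (hBj j) (hRj j) _ (-s) (mem_minus (hA j) (hBj j) ξ hs0'.le hs1)
    rw [hRξ, hLξ] at this
    simpa only [neg_mul, ← sub_eq_add_neg] using this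
  refine ⟨U, b, B⁻¹, hU, fun j i => ⟨hbpos j i, (hb j i).2⟩, ?_, ?_, hi, ?_⟩
  · rw [det_nonsing_inv]
    exact (hBu.ringInverse).ne_zero
  · have : (fun j => (U j)ᵀ * diagonal (b j) * U j) = A := by funext j; exact (hAU j).symm
    rw [this, hB, ← Matrix.mul_assoc, ← transpose_mul, hBB', transpose_one, Matrix.one_mul, hBB']
  · intro j hj i
    rcases (hb j i).2.eq_or_lt with h | h
    · exact Or.inl h
    · right
      have hsum : ∀ k, ∑ i', (Pi.single i 1 : κ j → ℝ) i' * (Bf (U j) (b j) * L j * B⁻¹) i' k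
          = (Bf (U j) (b j) * L j * B⁻¹) i k := fun k => by simp [Pi.single_apply]
      have hsq : ∑ i', (Pi.single i 1 : κ j → ℝ) i' ^ 2 = 1 := by simp [Pi.single_apply]
      refine le_antisymm ?_ ?_
      · have := hi j hj (Pi.single i 1)
        simpa only [hsum, hsq] using this
      · have key : -∑ k, (Bf (U j) (b j) * L j * B⁻¹) i k ^ 2 ≤ -1 := by
          refine first_order hj ?_
          have hev : ∀ᶠ s in nhdsWithin (0:ℝ) (Set.Ioi 0), b j i * (1 + s) < K := by
            refine (nhdsWithin_le_nhds) ?_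
            have hc : ContinuousAt (fun s : ℝ => b j i * (1 + s)) 0 := by fun_prop
            exact hc.eventually (gt_mem_nhds (by simpa using h))
          filter_upwards [hev, self_mem_nhdsWithin] with s hs hs0
          have hs0' : 0 < s := hs0
          have hm := mem_plus (hU j) (hb j) (hAU j ▸ hA j) i hs0'.le hs.le
          rw [← hAU j] at hm
          have := pert p hp L hδ hA hdet hmax hB hBB j (hBj j) (hRj j) _ s hm
          rw [hRξ, hLξ] at this
          simp only [hsum, hsq] at this
          convert this using 2 <;> ring
        linarith
end Opt
end BLC

namespace BLC
open Matrix

section Mix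
variable {ι ν : Type} {κ : ι → Type} [Fintype ι] [DecidableEq ι] [Fintype ν] [DecidableEq ν]
  [∀ j, Fintype (κ j)] [∀ j, DecidableEq (κ j)]

lemma det_le_of_quad {N M : Matrix ν ν ℝ} (hN : N.PosDef) (hM : M.PosDef)
    (h : ∀ x, x ⬝ᵥ (N *ᵥ x) ≤ x ⬝ᵥ (M *ᵥ x)) : N.det ≤ M.det := by
  obtain ⟨B, -, hB0, hB2, hBq⟩ := posDef_factor hN
  obtain ⟨C, -, hC0, hC2, hCq⟩ := posDef_factor hM
  have h1 : ENNReal.ofReal |C.det|⁻¹ ≤ ENNReal.ofReal |B.det|⁻¹ := by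
    rw [← lintegral_gauss_mat C hC0, ← lintegral_gauss_mat B hB0]
    refine lintegral_mono fun x => ENNReal.ofReal_le_ofReal (Real.exp_le_exp.2 ?_)
    have := h x
    rw [hBq, hCq] at this
    nlinarith [Real.pi_pos]
  have h2 := (ENNReal.ofReal_le_ofReal_iff (by positivity)).1 h1
  have h3 := (inv_le_inv₀ (abs_pos.2 hC0) (abs_pos.2 hB0)).1 h2
  rw [← hB2, ← hC2]
  exact sq_le_sq.2 h3

lemma MM_eq_quad (p : ι → ℝ) (L : ∀ j, Matrix (κ j) ν ℝ) (δ : ℝ) (U : ∀ j, Matrix (κ j) (κ j) ℝ)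
    (b : ∀ j, κ j → ℝ) (hb : ∀ j i, 0 ≤ b j i) (x : ν → ℝ) :
    x ⬝ᵥ (MM p L δ (fun j => (U j)ᵀ * diagonal (b j) * U j) *ᵥ x) = δ * (x ⬝ᵥ x) +
      ∑ j, p j * ∑ i, b j i * ((U j * L j) *ᵥ x) i ^ 2 := by
  rw [MM_quad]
  congr 1
  refine Finset.sum_congr rfl fun j _ => ?_
  congr 1
  rw [← Bf_mul (U j) (hb j), quad_factor]
  refine Finset.sum_congr rfl fun i _ => ?_
  rw [Bf_mulVec, mul_pow, Real.sq_sqrt (hb j i), mulVec_mulVec]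

lemma GM_posSemidef (p : ι → ℝ) (hp : ∀ j, 0 ≤ p j) (L : ∀ j, Matrix (κ j) ν ℝ) (U : ∀ j, Matrix (κ j) (κ j) ℝ)
    (b : ∀ j, κ j → ℝ) (hb : ∀ j i, 0 ≤ b j i) : (GM p L U b).PosSemidef := by
  refine Matrix.PosSemidef.of_dotProduct_mulVec_nonneg (GM_symm p L U b) fun x => ?_
  rw [star_trivial, GM_quad]
  exact Finset.sum_nonneg fun j _ => mul_nonneg (hp j)
    (Finset.sum_nonneg fun i _ => mul_nonneg (hb j i) (sq_nonneg _))

lemma GB_MM (p : ι → ℝ) (hp : ∀ j, 0 ≤ p j) (L : ∀ j, Matrix (κ j) ν ℝ) {δ : ℝ} (hδ : 0 < δ)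
    {D : ℝ} (hD : 0 ≤ D) (hG : GB p L D) (U : ∀ j, Matrix (κ j) (κ j) ℝ)
    (hU : ∀ j, U j ∈ Matrix.orthogonalGroup (κ j) ℝ)
    (b : ∀ j, κ j → ℝ) (hb : ∀ j i, 0 < b j i) {R : Matrix ν ν ℝ}
    (hR : Rᵀ * MM p L δ (fun j => (U j)ᵀ * diagonal (b j) * U j) * R = 1) :
    |R.det| ^ 2 * ∏ j, (∏ i, b j i) ^ p j ≤ D := by
  set M := MM p L δ (fun j => (U j)ᵀ * diagonal (b j) * U j) with hM
  have h0 := hG U hU b hb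
  have h1 : 0 < ∏ j, (∏ i, b j i) ^ p j :=
    Finset.prod_pos fun j _ => Real.rpow_pos_of_pos (Finset.prod_pos fun i _ => hb j i) _
  have h2 : (GM p L U b).det ≠ 0 := by
    intro h; rw [h] at h0; linarith
  have hGp : (GM p L U b).PosDef :=
    (GM_posSemidef p hp L U b fun j i => (hb j i).le).posDef_iff_det_ne_zero.2 h2
  have hMe : M = GM p L U b + δ • (1 : Matrix ν ν ℝ) := by
    rw [hM, MM, add_comm]
    congr 1
    ext x y
    simp only [GM, Matrix.sum_apply, Matrix.smul_apply, Matrix.of_apply, Fintype.sum_sigma, smul_eq_mul]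
    refine Finset.sum_congr rfl fun j _ => ?_
    have : (L j)ᵀ * ((U j)ᵀ * diagonal (b j) * U j) * L j
        = (U j * L j)ᵀ * (diagonal (b j) * (U j * L j)) := by
      rw [transpose_mul]; simp only [Matrix.mul_assoc]
    rw [this, Matrix.mul_apply, Finset.mul_sum]
    refine Finset.sum_congr rfl fun i _ => ?_
    rw [diagonal_mul, transpose_apply]; ring
  have hMp : M.PosDef := hMe ▸ GM_delta_posDef p hp L U b (fun j i => (hb j i).le) δ hδ
  have hle : (GM p L U b).det ≤ M.det := by
    refine det_le_of_quad hGp hMp fun x => ?_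
    rw [hMe, add_mulVec, dotProduct_add, smul_mulVec, one_mulVec, dotProduct_smul]
    have : 0 ≤ x ⬝ᵥ x := by
      simp only [dotProduct]; exact Finset.sum_nonneg fun i _ => mul_self_nonneg _
    have := mul_nonneg hδ.le this
    simp only [smul_eq_mul]; linarith
  have hdet : R.det ^ 2 * M.det = 1 := by
    have := congrArg Matrix.det hR
    rw [det_mul, det_mul, det_transpose, det_one] at this
    linarith
  rw [sq_abs]
  calc R.det ^ 2 * ∏ j, (∏ i, b j i) ^ p j ≤ R.det ^ 2 * (D * (GM p L U b).det) := by gcongr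
    _ ≤ R.det ^ 2 * (D * M.det) := by gcongr
    _ = D * (R.det ^ 2 * M.det) := by ring
    _ = D := by rw [hdet, mul_one]

/-- extension of an index family by one more member -/
def OK (α : Type) (κ : ι → Type) : Option ι → Type
  | none => α
  | some j => κ j

instance OKfin (α : Type) (κ : ι → Type) [Fintype α] [∀ j, Fintype (κ j)] : ∀ o, Fintype (OK α κ o)
  | none => inferInstanceAs (Fintype α)
  | some j => inferInstanceAs (Fintype (κ j))

/-- dependent eliminator -/
def oe {T : Option ι → Type} (a : T none) (f : ∀ j, T (some j)) : ∀ o, T o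
  | none => a
  | some j => f j

variable {σ : ι → Type} [∀ j, Fintype (σ j)]

/-- normalised data from the optimiser -/
noncomputable def mkDat (p : ι → ℝ) (hp : ∀ j, 0 ≤ p j) (L : ∀ j, Matrix (κ j) ν ℝ) {δ : ℝ} (hδ : 0 < δ)
    {K : ℝ} (hK : 0 < K) (U : ∀ j, Matrix (κ j) (κ j) ℝ) (b : ∀ j, κ j → ℝ) (R : Matrix ν ν ℝ)
    (hb : ∀ j i, 0 < b j i ∧ b j i ≤ K)
    (hR : Rᵀ * MM p L δ (fun j => (U j)ᵀ * diagonal (b j) * U j) * R = 1)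
    (hN : ∀ j, 0 < p j → ∀ ξ : κ j → ℝ,
        ∑ k, (∑ i, ξ i * (Bf (U j) (b j) * L j * R) i k) ^ 2 ≤ ∑ i, ξ i ^ 2)
    (hE : ∀ j, 0 < p j → ∀ i, b j i = K ∨ ∑ k, (Bf (U j) (b j) * L j * R) i k ^ 2 = 1)
    (c : ∀ j, σ j → ℝ) (hc : ∀ j s, 0 ≤ c j s) (hc1 : ∀ j, ∃ s, 0 < c j s) (a : ∀ j, σ j → κ j → ℝ) :
    Dat (Option ι) ν (OK ν κ) (OK Unit σ) where
  p := oe (T := fun _ => ℝ) 1 p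
  hp := by rintro (_ | j); exacts [zero_le_one, hp j]
  l := oe (T := fun o => OK ν κ o → ν → ℝ) (fun i k => √δ * R i k) (fun j => Bf (U j) (b j) * L j * R)
  th := oe (T := fun o => OK ν κ o → ℝ) (fun _ => 1) (fun j i => b j i / K)
  th0 := by rintro (_ | j) i; exacts [zero_lt_one, div_pos (hb j i).1 hK]
  th1 := by rintro (_ | j) i; exacts [le_rfl, (div_le_one hK).2 (hb j i).2]
  c := oe (T := fun o => OK Unit σ o → ℝ) (fun _ => 1) c
  c0 := by rintro (_ | j) s; exacts [zero_le_one, hc j s]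
  c1 := by rintro (_ | j); exacts [⟨(), zero_lt_one⟩, hc1 j]
  a := oe (T := fun o => OK Unit σ o → OK ν κ o → ℝ) (fun _ _ => 0) (fun j s => (Bf (U j) (b j) *ᵥ a j s : κ j → ℝ))
  frame := by
    intro k k'
    rw [Fintype.sum_option]
    have e1 : Rᵀ * MM p L δ (fun j => (U j)ᵀ * diagonal (b j) * U j) * R =
        δ • (Rᵀ * R) + ∑ j, p j • ((Bf (U j) (b j) * L j * R)ᵀ * (Bf (U j) (b j) * L j * R)) := by
      rw [MM, Matrix.mul_add, Matrix.add_mul, Matrix.mul_smul, Matrix.smul_mul, Matrix.mul_one,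
        Matrix.mul_sum, Matrix.sum_mul]
      congr 1
      refine Finset.sum_congr rfl fun j _ => ?_
      rw [Matrix.mul_smul, Matrix.smul_mul, ← Bf_mul (U j) (fun i => (hb j i).1.le)]
      simp only [transpose_mul, Matrix.mul_assoc]
    have e2 := congrFun (congrFun (e1.symm.trans hR) k) k'
    rw [Matrix.one_apply, Matrix.add_apply, Matrix.sum_apply, Matrix.smul_apply, Matrix.mul_apply] at e2
    rw [← e2]
    congr 1
    · change (1:ℝ) * ∑ i : ν, (√δ * R i k) * (√δ * R i k') = _
      rw [one_mul, smul_eq_mul, Finset.mul_sum]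
      refine Finset.sum_congr rfl fun i _ => ?_
      rw [transpose_apply]
      nth_rewrite 3 [← Real.mul_self_sqrt hδ.le]
      ring
  hN := by
    rintro (_ | j)
    · intro _ ξ
      change ∑ k, (∑ i : ν, ξ i * (√δ * R i k)) ^ 2 ≤ ∑ i : ν, ξ i ^ 2
      change ν → ℝ at ξ
      set y : ν → ℝ := fun k => ∑ i : ν, ξ i * (√δ * R i k) with hy
      have h1 : δ * ∑ i, (R *ᵥ y) i ^ 2 ≤ ∑ k, y k ^ 2 := by
        have h2 := MM_eq_quad p L δ U b (fun j i => (hb j i).1.le) (R *ᵥ y)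
        have h3 : (R *ᵥ y) ⬝ᵥ (MM p L δ (fun j => (U j)ᵀ * diagonal (b j) * U j) *ᵥ (R *ᵥ y)) = y ⬝ᵥ y := by
          have : y ⬝ᵥ (Rᵀ * MM p L δ (fun j => (U j)ᵀ * diagonal (b j) * U j) * R) *ᵥ y = y ⬝ᵥ y := by
            rw [hR, one_mulVec]
          rw [← this, Matrix.mul_assoc, ← mulVec_mulVec, ← mulVec_mulVec, dotProduct_mulVec y, vecMul_transpose]
        have h4 : 0 ≤ ∑ j, p j * ∑ i, b j i * ((U j * L j) *ᵥ (R *ᵥ y)) i ^ 2 :=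
          Finset.sum_nonneg fun j _ => mul_nonneg (hp j)
            (Finset.sum_nonneg fun i _ => mul_nonneg (hb j i).1.le (sq_nonneg _))
        rw [h3] at h2
        have h5 : ∑ k, y k ^ 2 = y ⬝ᵥ y := by simp [dotProduct, sq]
        have h6 : ∑ k, (R *ᵥ y) k ^ 2 = (R *ᵥ y) ⬝ᵥ (R *ᵥ y) := by simp [dotProduct, sq]
        rw [h5, h6]; linarith
      have h7 : ∑ k, y k ^ 2 = ∑ i, ξ i * (√δ * (R *ᵥ y) i) := by
        have : ∀ k, y k ^ 2 = ∑ i : ν, ξ i * (√δ * R i k) * y k := by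
          intro k; rw [sq, ← Finset.sum_mul]
        simp_rw [this]
        rw [Finset.sum_comm]
        refine Finset.sum_congr rfl fun i _ => ?_
        rw [mulVec, dotProduct, Finset.mul_sum, Finset.mul_sum]
        exact Finset.sum_congr rfl fun k _ => by ring
      have h8 : (∑ i, ξ i * (√δ * (R *ᵥ y) i)) ^ 2 ≤ (∑ i, ξ i ^ 2) * ∑ i, (√δ * (R *ᵥ y) i) ^ 2 :=
        Finset.sum_mul_sq_le_sq_mul_sq _ _ _
      have h9 : ∑ i, (√δ * (R *ᵥ y) i) ^ 2 = δ * ∑ i, (R *ᵥ y) i ^ 2 := by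
        rw [Finset.mul_sum]
        exact Finset.sum_congr rfl fun i _ => by rw [mul_pow, Real.sq_sqrt hδ.le]
      rw [h9, ← h7] at h8
      have hS : 0 ≤ ∑ k, y k ^ 2 := Finset.sum_nonneg fun k _ => sq_nonneg _
      have hX : 0 ≤ ∑ i, ξ i ^ 2 := Finset.sum_nonneg fun k _ => sq_nonneg _
      rcases hS.eq_or_lt with h | h
      · rw [← h]; exact hX
      · have := h8.trans (mul_le_mul_of_nonneg_left h1 hX)
        rw [sq] at this
        exact le_of_mul_le_mul_right this h
    · exact hN j
  hE := by
    rintro (_ | j)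
    · exact fun _ i => Or.inl rfl
    · intro h i
      rcases hE j h i with h | h
      · left
        change b j i / K = 1
        rw [h, div_self hK.ne']
      · exact Or.inr h

lemma mix_factor {κ σ : Type} [Fintype κ] [DecidableEq κ] [Fintype σ] (K : ℝ) (hK : 0 < K) (U : Matrix κ κ ℝ)
    (hU : U ∈ Matrix.orthogonalGroup κ ℝ) (b : κ → ℝ) (hb : ∀ i, 0 < b i) (c : σ → ℝ) (a : σ → κ → ℝ) (z : κ → ℝ) :
    ∑ s, c s * ∏ i, ((√(b i / K))⁻¹ * Real.exp (-Real.pi * ((Bf U b *ᵥ z) i - (Bf U b *ᵥ a s) i) ^ 2 / (b i / K)))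
    = (∏ i, √(b i))⁻¹ * ∑ s, c s * ∏ i, (√K * Real.exp (-Real.pi * K * (z i - a s i) ^ 2)) := by
  rw [Finset.mul_sum]
  refine Finset.sum_congr rfl fun s _ => ?_
  rw [mul_left_comm]
  congr 1
  have e0 : (∏ i, (√(b i / K))⁻¹) = (∏ i, √(b i))⁻¹ * ∏ _i : κ, √K := by
    rw [← Finset.prod_inv_distrib, ← Finset.prod_mul_distrib]
    refine Finset.prod_congr rfl fun i _ => ?_
    rw [Real.sqrt_div (hb i).le, inv_div, div_eq_mul_inv, mul_comm]
  rw [Finset.prod_mul_distrib, Finset.prod_mul_distrib, ← mul_assoc, ← e0]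
  congr 1
  · rw [← Real.exp_sum, ← Real.exp_sum]
    congr 1
    have h : ∀ i, -Real.pi * ((Bf U b *ᵥ z) i - (Bf U b *ᵥ a s) i) ^ 2 / (b i / K)
        = -Real.pi * K * (U *ᵥ (z - a s)) i ^ 2 := by
      intro i
      rw [Bf_mulVec, Bf_mulVec, ← mul_sub, mul_pow, Real.sq_sqrt (hb i).le, mulVec_sub, Pi.sub_apply]
      field_simp [(hb i).ne']
    simp_rw [h]
    rw [← Finset.mul_sum, orth_sq hU, Finset.mul_sum]
    rfl

theorem mix_bound (p : ι → ℝ) (hp : ∀ j, 0 ≤ p j) (L : ∀ j, Matrix (κ j) ν ℝ) {δ : ℝ} (hδ : 0 < δ)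
    {K : ℝ} (hK : 0 < K) {D : ℝ} (hD : 0 ≤ D) (hG : GB p L D)
    (c : ∀ j, σ j → ℝ) (hc : ∀ j s, 0 ≤ c j s) (hc1 : ∀ j, ∃ s, 0 < c j s) (a : ∀ j, σ j → κ j → ℝ) :
    ∫⁻ x : ν → ℝ, ENNReal.ofReal (Real.exp (-Real.pi * δ * ∑ k, x k ^ 2) *
      ∏ j, (∑ s, c j s * ∏ i, (√K * Real.exp (-Real.pi * K * ((L j *ᵥ x) i - a j s i) ^ 2))) ^ p j)
    ≤ ENNReal.ofReal (√D * ∏ j, (∑ s, c j s) ^ p j) := by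
  obtain ⟨U, b, R, hU, hb, hRd, hR, hN, hE⟩ := opt_exists p hp L hδ hK
  have hcore := (mkDat p hp L hδ hK U b R hb hR hN hE c hc hc1 a).core'
  set F : (ν → ℝ) → ℝ≥0∞ := fun x => ENNReal.ofReal (Real.exp (-Real.pi * δ * ∑ k, x k ^ 2) *
      ∏ j, (∑ s, c j s * ∏ i, (√K * Real.exp (-Real.pi * K * ((L j *ᵥ x) i - a j s i) ^ 2))) ^ p j) with hF
  have hFm : Measurable F := by
    rw [hF]
    refine Continuous.measurable ?_
    refine ENNReal.continuous_ofReal.comp ?_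
    refine Continuous.mul (by fun_prop) (continuous_finsetProd _ fun j _ => ?_)
    refine Continuous.rpow_const ?_ fun x => Or.inr (hp j)
    have : Continuous fun x : ν → ℝ => L j *ᵥ x := by fun_prop
    fun_prop
  set P := ∏ j, ((∏ i, √(b j i))⁻¹) ^ p j with hP
  have hP0 : 0 < P := Finset.prod_pos fun j _ => Real.rpow_pos_of_pos
    (inv_pos.2 (Finset.prod_pos fun i _ => Real.sqrt_pos.2 (hb j i).1)) _
  have e1 : ∀ y : ν → ℝ, ENNReal.ofReal (∏ j, (∑ s, (mkDat p hp L hδ hK U b R hb hR hN hE c hc hc1 a).c j s *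
    ∏ i, ((Real.sqrt ((mkDat p hp L hδ hK U b R hb hR hN hE c hc hc1 a).th j i))⁻¹ *
      Real.exp (-Real.pi * ((mkDat p hp L hδ hK U b R hb hR hN hE c hc hc1 a).Y j i y
        - (mkDat p hp L hδ hK U b R hb hR hN hE c hc hc1 a).a j s i) ^ 2 /
          (mkDat p hp L hδ hK U b R hb hR hN hE c hc hc1 a).th j i))) ^
          (mkDat p hp L hδ hK U b R hb hR hN hE c hc hc1 a).p j)
      = ENNReal.ofReal P * F (R *ᵥ y) := by
    intro y
    rw [hF]
    dsimp only
    rw [← ENNReal.ofReal_mul hP0.le]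
    congr 1
    rw [Fintype.prod_option, mul_left_comm]
    congr 1
    · change (∑ s : Unit, (1:ℝ) * ∏ i : ν, ((√1)⁻¹ * Real.exp (-Real.pi * ((∑ k, √δ * R i k * y k) - 0) ^ 2 / 1))) ^ (1:ℝ)
        = _
      rw [Real.rpow_one]
      simp only [Finset.univ_unique, Finset.sum_singleton, Real.sqrt_one, inv_one, one_mul, sub_zero, div_one]
      rw [← Real.exp_sum]
      congr 1
      rw [Finset.mul_sum]
      refine Finset.sum_congr rfl fun i _ => ?_
      have : ∑ k, √δ * R i k * y k = √δ * (R *ᵥ y) i := by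
        rw [mulVec, dotProduct, Finset.mul_sum]
        exact Finset.sum_congr rfl fun k _ => by ring
      rw [this, mul_pow, Real.sq_sqrt hδ.le]; ring
    · rw [hP, ← Finset.prod_mul_distrib]
      refine Finset.prod_congr rfl fun j _ => ?_
      rw [← Real.mul_rpow (inv_nonneg.2 (Finset.prod_nonneg fun i _ => Real.sqrt_nonneg _))
        (Finset.sum_nonneg fun s _ => mul_nonneg (hc j s) (Finset.prod_nonneg fun i _ => by positivity)),
        ← mix_factor K hK (U j) (hU j) (b j) (fun i => (hb j i).1)]
      rw [mulVec_mulVec, mulVec_mulVec]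
      rfl
  have e2 : ∏ j, (∑ s, (mkDat p hp L hδ hK U b R hb hR hN hE c hc hc1 a).c j s) ^
      (mkDat p hp L hδ hK U b R hb hR hN hE c hc hc1 a).p j = ∏ j, (∑ s, c j s) ^ p j := by
    rw [Fintype.prod_option]
    change (∑ s : Unit, (1:ℝ)) ^ (1:ℝ) * _ = _
    rw [Real.rpow_one]
    simp only [Finset.univ_unique, Finset.sum_singleton, one_mul]
    rfl
  rw [e2] at hcore
  simp_rw [e1] at hcore
  rw [lintegral_const_mul _ (by fun_prop), lintegral_mulVec R hRd F hFm] at hcore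
  have hdp : 0 < |R.det| := abs_pos.2 hRd
  have hkey : |R.det| * P⁻¹ ≤ √D := by
    refine Real.le_sqrt_of_sq_le ?_
    refine le_trans (le_of_eq ?_) (GB_MM p hp L hδ hD hG U hU b (fun j i => (hb j i).1) hR)
    rw [mul_pow]
    congr 1
    rw [hP, ← Finset.prod_inv_distrib, ← Finset.prod_pow]
    refine Finset.prod_congr rfl fun j _ => ?_
    have h0 : 0 ≤ ∏ i, √(b j i) := Finset.prod_nonneg fun i _ => Real.sqrt_nonneg _
    rw [Real.inv_rpow h0, inv_inv, ← Real.rpow_natCast, ← Real.rpow_mul h0, mul_comm, Real.rpow_mul h0,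
      Real.rpow_natCast, ← Finset.prod_pow]
    congr 1
    exact Finset.prod_congr rfl fun i _ => Real.sq_sqrt (hb j i).1.le
  have hS : 0 ≤ ∏ j, (∑ s, c j s) ^ p j :=
    Finset.prod_nonneg fun j _ => Real.rpow_nonneg (Finset.sum_nonneg fun s _ => hc j s) _
  calc ∫⁻ x, F x = ENNReal.ofReal (|R.det| * P⁻¹) *
        (ENNReal.ofReal P * (ENNReal.ofReal |R.det|⁻¹ * ∫⁻ x, F x)) := by
        rw [← mul_assoc, ← mul_assoc, ← ENNReal.ofReal_mul (by positivity), ← ENNReal.ofReal_mul (by positivity)]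
        rw [show |R.det| * P⁻¹ * P * |R.det|⁻¹ = 1 by field_simp, ENNReal.ofReal_one, one_mul]
    _ ≤ ENNReal.ofReal (√D) * ENNReal.ofReal (∏ j, (∑ s, c j s) ^ p j) := by
        gcongr
    _ = _ := by rw [← ENNReal.ofReal_mul (Real.sqrt_nonneg _)]

end Mix
end BLC

namespace BLC
open Matrix Filter Topology

section Liminf

lemma rpow_le_liminf {α : Type*} {F : Filter α} [F.NeBot] {u : α → ℝ≥0∞} {a : ℝ≥0∞} {p : ℝ} (hp : 0 ≤ p)
    (h : a ≤ liminf u F) : a ^ p ≤ liminf (fun n => u n ^ p) F := by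
  have hm : Monotone fun x : ℝ≥0∞ => x ^ p := ENNReal.monotone_rpow_of_nonneg hp
  have := hm.map_liminf_of_continuousAt (F := F) u ENNReal.continuous_rpow_const.continuousAt
  exact (ENNReal.rpow_le_rpow h hp).trans this.le

lemma prod_le_liminf {α ι : Type*} {F : Filter α} [F.NeBot] (s : Finset ι) {u : ι → α → ℝ≥0∞} {a : ι → ℝ≥0∞}
    (h : ∀ j, a j ≤ liminf (u j) F) : ∏ j ∈ s, a j ≤ liminf (fun n => ∏ j ∈ s, u j n) F := by
  classical
  induction s using Finset.induction_on with
  | empty => simp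
  | insert j s hj ih =>
    simp only [Finset.prod_insert hj]
    exact (mul_le_mul' (h j) ih).trans ENNReal.le_liminf_mul

lemma prod_rpow_le_liminf {α ι : Type*} [Fintype ι] {F : Filter α} [F.NeBot] {u : ι → α → ℝ≥0∞} {a : ι → ℝ≥0∞}
    {p : ι → ℝ} (hp : ∀ j, 0 ≤ p j)
    (h : ∀ j, a j ≤ liminf (u j) F) : ∏ j, a j ^ p j ≤ liminf (fun n => ∏ j, u j n ^ p j) F :=
  prod_le_liminf (u := fun j n => u j n ^ p j) Finset.univ fun j => rpow_le_liminf (hp j) (h j)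

lemma lsc_le_liminf {α X : Type*} [TopologicalSpace X] {F : Filter α} {g : X → ℝ≥0∞} (hg : LowerSemicontinuous g)
    {u : α → X} {x : X} (hu : Tendsto u F (𝓝 x)) : g x ≤ liminf (fun n => g (u n)) F := by
  refine le_of_forall_lt fun b hb => ?_
  obtain ⟨b', h1, h2⟩ := exists_between hb
  have h3 : ∀ᶠ n in F, b' ≤ g (u n) := by
    filter_upwards [hu.eventually (hg x b' h2)] with n hn using hn.le
  exact lt_of_lt_of_le h1 (le_liminf_of_le (by isBoundedDefault) h3)

end Liminf

section Conv
variable {ι ν : Type} {κ : ι → Type} [Fintype ι] [DecidableEq ι] [Fintype ν] [DecidableEq ν]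
  [∀ j, Fintype (κ j)] [∀ j, DecidableEq (κ j)] {σ : ι → Type} [∀ j, Fintype (σ j)]

/-- normalised Gaussian -/
noncomputable def gam {κ : Type} [Fintype κ] (K : ℝ) (z : κ → ℝ) : ℝ≥0∞ :=
  ENNReal.ofReal (∏ i, (√K * Real.exp (-Real.pi * K * z i ^ 2)))

lemma continuous_gam {κ : Type} [Fintype κ] (K : ℝ) : Continuous (gam (κ := κ) K) := by
  unfold gam
  exact ENNReal.continuous_ofReal.comp (by fun_prop)

/-- Gaussian damping -/
noncomputable def damp {ν : Type} [Fintype ν] (δ : ℝ) (x : ν → ℝ) : ℝ≥0∞ :=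
  ENNReal.ofReal (Real.exp (-Real.pi * δ * ∑ k, x k ^ 2))

lemma continuous_damp (δ : ℝ) : Continuous (damp (ν := ν) δ) := by
  unfold damp
  exact ENNReal.continuous_ofReal.comp (by fun_prop)

theorem mix_bound_enn (p : ι → ℝ) (hp : ∀ j, 0 ≤ p j) (L : ∀ j, Matrix (κ j) ν ℝ) {δ : ℝ} (hδ : 0 < δ)
    {K : ℝ} (hK : 0 < K) {D : ℝ} (hD : 0 ≤ D) (hG : GB p L D)
    (c : ∀ j, σ j → ℝ≥0∞) (hc : ∀ j s, c j s ≠ ⊤) (hc1 : ∀ j, ∃ s, c j s ≠ 0) (a : ∀ j, σ j → κ j → ℝ) :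
    ∫⁻ x : ν → ℝ, damp δ x * ∏ j, (∑ s, gam K (L j *ᵥ x - a j s) * c j s) ^ p j
    ≤ ENNReal.ofReal (√D) * ∏ j, (∑ s, c j s) ^ p j := by
  have h := mix_bound p hp L hδ hK hD hG (fun j s => (c j s).toReal) (fun j s => ENNReal.toReal_nonneg)
    (fun j => (hc1 j).imp fun s hs => ENNReal.toReal_pos hs (hc j s)) a
  rw [ENNReal.ofReal_mul (Real.sqrt_nonneg _), ENNReal.ofReal_prod_of_nonneg
    (fun j _ => Real.rpow_nonneg (Finset.sum_nonneg fun s _ => ENNReal.toReal_nonneg) _)] at h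
  have e1 : ∀ j, ENNReal.ofReal ((∑ s, (c j s).toReal) ^ p j) = (∑ s, c j s) ^ p j := by
    intro j
    rw [← ENNReal.ofReal_rpow_of_nonneg (Finset.sum_nonneg fun s _ => ENNReal.toReal_nonneg) (hp j),
      ENNReal.ofReal_sum_of_nonneg fun s _ => ENNReal.toReal_nonneg]
    simp_rw [ENNReal.ofReal_toReal (hc j _)]
  simp_rw [e1] at h
  refine le_trans (le_of_eq (lintegral_congr fun x => ?_)) h
  rw [ENNReal.ofReal_mul (Real.exp_pos _).le, ENNReal.ofReal_prod_of_nonneg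
    (fun j _ => Real.rpow_nonneg (Finset.sum_nonneg fun s _ => mul_nonneg ENNReal.toReal_nonneg
      (Finset.prod_nonneg fun i _ => by positivity)) _)]
  unfold damp
  congr 1
  refine Finset.prod_congr rfl fun j _ => ?_
  rw [← ENNReal.ofReal_rpow_of_nonneg (Finset.sum_nonneg fun s _ => mul_nonneg ENNReal.toReal_nonneg
      (Finset.prod_nonneg fun i _ => by positivity)) (hp j),
      ENNReal.ofReal_sum_of_nonneg fun s _ => mul_nonneg ENNReal.toReal_nonneg
      (Finset.prod_nonneg fun i _ => by positivity)]
  congr 1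
  refine Finset.sum_congr rfl fun s _ => ?_
  rw [ENNReal.ofReal_mul ENNReal.toReal_nonneg, ENNReal.ofReal_toReal (hc j s), mul_comm]
  rfl

theorem conv_bound (p : ι → ℝ) (hp : ∀ j, 0 ≤ p j) (L : ∀ j, Matrix (κ j) ν ℝ) {δ : ℝ} (hδ : 0 < δ)
    {K : ℝ} (hK : 0 < K) {D : ℝ} (hD : 0 ≤ D) (hG : GB p L D)
    (g : ∀ j, (κ j → ℝ) → ℝ≥0∞) (hg : ∀ j, Measurable (g j)) (hg0 : ∀ j, 0 < ∫⁻ y, g j y)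
    (hg1 : ∀ j, ∫⁻ y, g j y < ⊤) :
    ∫⁻ x : ν → ℝ, damp δ x * ∏ j, (∫⁻ a, gam K (L j *ᵥ x - a) * g j a) ^ p j
    ≤ ENNReal.ofReal (√D) * ∏ j, (∫⁻ y, g j y) ^ p j := by
  let μ : ∀ j, Measure (κ j → ℝ) := fun j => volume.withDensity (g j)
  let π : ∀ j, ℕ → SimpleFunc (κ j → ℝ) (κ j → ℝ) := fun j n =>
    SimpleFunc.approxOn id measurable_id Set.univ 0 (Set.mem_univ _) n
  have hπ : ∀ j a, Tendsto (fun n => π j n a) atTop (𝓝 a) := fun j a =>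
    SimpleFunc.tendsto_approxOn measurable_id (Set.mem_univ _) (by simp)
  have hμ : ∀ j, μ j Set.univ = ∫⁻ y, g j y := fun j => by simp [μ]
  have e1 : ∀ j (z : κ j → ℝ), ∫⁻ a, gam K (z - a) * g j a = ∫⁻ a, gam K (z - a) ∂(μ j) := by
    intro j z
    have hm : Measurable fun a : κ j → ℝ => gam K (z - a) :=
      ((continuous_gam K).comp (by fun_prop)).measurable
    rw [lintegral_withDensity_eq_lintegral_mul _ (hg j) hm]
    exact lintegral_congr fun a => mul_comm _ _
  have e2 : ∀ j n (z : κ j → ℝ), ∫⁻ a, gam K (z - π j n a) ∂(μ j) =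
      ∑ s : (π j n).range, gam K (z - s.1) * μ j (π j n ⁻¹' {s.1}) := by
    intro j n z
    rw [Finset.sum_coe_sort (π j n).range fun v => gam K (z - v) * μ j (π j n ⁻¹' {v}),
      ← SimpleFunc.map_lintegral (fun v => gam K (z - v)) (π j n), ← SimpleFunc.lintegral_eq_lintegral]
    rfl
  have e3 : ∀ j n, ∑ s : (π j n).range, μ j (π j n ⁻¹' {s.1}) = ∫⁻ y, g j y := by
    intro j n
    rw [← hμ, Finset.sum_coe_sort (π j n).range fun v => μ j (π j n ⁻¹' {v})]
    exact (π j n).sum_measure_preimage_singleton (π j n).range |>.trans (by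
      congr 1; ext x; simp)
  have hb : ∀ n, ∫⁻ x : ν → ℝ, damp δ x * ∏ j, (∫⁻ a, gam K (L j *ᵥ x - π j n a) ∂(μ j)) ^ p j
      ≤ ENNReal.ofReal (√D) * ∏ j, (∫⁻ y, g j y) ^ p j := by
    intro n
    simp_rw [e2, ← e3 _ n]
    refine mix_bound_enn (σ := fun j => (π j n).range) p hp L hδ hK hD hG
      (fun j s => μ j (π j n ⁻¹' {s.1})) ?_ ?_ (fun j s => s.1)
    · intro j s
      exact ((measure_mono (Set.subset_univ _)).trans_lt ((hμ j).trans_lt (hg1 j))).ne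
    · intro j
      by_contra hcon
      push Not at hcon
      have := e3 j n
      rw [Finset.sum_eq_zero fun s _ => hcon s] at this
      exact (hg0 j).ne this
  have hm : ∀ n, Measurable fun x : ν → ℝ => damp δ x * ∏ j, (∫⁻ a, gam K (L j *ᵥ x - π j n a) ∂(μ j)) ^ p j := by
    intro n
    simp_rw [e2]
    refine (continuous_damp δ).measurable.mul (Finset.measurable_fun_prod _ fun j _ => ?_)
    refine Measurable.pow_const ?_ _
    refine Finset.measurable_fun_sum _ fun s _ => Measurable.mul_const ?_ _
    exact ((continuous_gam K).comp (by fun_prop)).measurable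
  calc _ ≤ ∫⁻ x : ν → ℝ, liminf (fun n => damp δ x *
        ∏ j, (∫⁻ a, gam K (L j *ᵥ x - π j n a) ∂(μ j)) ^ p j) atTop := by
        refine lintegral_mono fun x => ?_
        refine le_trans (mul_le_mul' (b := liminf (fun _ : ℕ => damp δ x) atTop) (by simp)
          (prod_rpow_le_liminf hp fun j => ?_)) ENNReal.le_liminf_mul
        rw [e1]
        refine le_trans (lintegral_mono fun a => ?_) (lintegral_liminf_le (u := atTop) fun n => ?_)
        · exact lsc_le_liminf (g := fun a => gam K (L j *ᵥ x - a))
            ((continuous_gam K).comp (by fun_prop)).lowerSemicontinuous (hπ j a)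
        · exact ((continuous_gam K).comp (g := gam K) (f := fun b => L j *ᵥ x - b) (by fun_prop)).measurable.comp (π j n).measurable
    _ ≤ liminf (fun n => ∫⁻ x : ν → ℝ, damp δ x *
        ∏ j, (∫⁻ a, gam K (L j *ᵥ x - π j n a) ∂(μ j)) ^ p j) atTop := lintegral_liminf_le hm
    _ ≤ _ := by
        refine (liminf_le_liminf (Eventually.of_forall hb)).trans ?_
        simp

lemma conv_scale {κ : Type} [Fintype κ] [DecidableEq κ] {K : ℝ} (hK : 0 < K) (g : (κ → ℝ) → ℝ≥0∞)
    (hg : Measurable g) (y : κ → ℝ) :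
    ∫⁻ a, gam K (y - a) * g a = ∫⁻ u, gam 1 u * g (y - (√K)⁻¹ • u) := by
  have h1 : ∫⁻ a, gam K (y - a) * g a = ∫⁻ w, gam K w * g (y - w) := by
    rw [← lintegral_sub_left_eq_self (μ := volume) (fun a => gam K (y - a) * g a) y]
    simp
  have hs : 0 < √K := Real.sqrt_pos.2 hK
  set A : Matrix κ κ ℝ := (√K)⁻¹ • (1 : Matrix κ κ ℝ) with hA
  have hdet : A.det = ((√K)⁻¹) ^ Fintype.card κ := by rw [hA, det_smul, det_one, mul_one]
  have hd0 : A.det ≠ 0 := by rw [hdet]; positivity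
  have h2 := lintegral_mulVec A hd0 (fun w => gam K w * g (y - w))
    ((continuous_gam K).measurable.mul (hg.comp (by fun_prop)))
  have hmv : ∀ u : κ → ℝ, A *ᵥ u = (√K)⁻¹ • u := by
    intro u; rw [hA, smul_mulVec, one_mulVec]
  have h3 : ∀ u : κ → ℝ, gam K ((√K)⁻¹ • u) = ENNReal.ofReal |A.det|⁻¹ * gam 1 u := by
    intro u
    unfold gam
    rw [← ENNReal.ofReal_mul (by positivity), hdet, abs_of_pos (by positivity), ← inv_pow, inv_inv]
    congr 1
    rw [Finset.prod_mul_distrib, Finset.prod_mul_distrib, Finset.prod_const, Real.sqrt_one, Finset.prod_const_one,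
      one_mul, Finset.card_univ]
    congr 1
    refine Finset.prod_congr rfl fun i _ => ?_
    congr 1
    rw [Pi.smul_apply, smul_eq_mul, mul_pow, inv_pow, Real.sq_sqrt hK.le]
    field_simp
  simp_rw [hmv, h3, mul_assoc] at h2
  have hm : Measurable fun x : κ → ℝ => gam 1 x * g (y - (√K)⁻¹ • x) :=
    (continuous_gam 1).measurable.mul (hg.comp (by fun_prop))
  rw [lintegral_const_mul _ hm] at h2
  rw [h1]
  refine ((ENNReal.mul_right_inj ?_ ENNReal.ofReal_ne_top).1 h2).symm
  rw [Ne, ENNReal.ofReal_eq_zero, not_le]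
  positivity

lemma lintegral_gam_one (κ : Type) [Fintype κ] : ∫⁻ u : κ → ℝ, gam 1 u = 1 := by
  rw [← lintegral_gauss_one κ]
  refine lintegral_congr fun u => ?_
  unfold gam
  simp only [Real.sqrt_one, one_mul, mul_one]
  rw [← Real.exp_sum, Finset.mul_sum]

lemma conv_liminf {κ : Type} [Fintype κ] [DecidableEq κ] (g : (κ → ℝ) → ℝ≥0∞)
    (hg : LowerSemicontinuous g) (y : κ → ℝ) :
    g y ≤ liminf (fun n : ℕ => ∫⁻ a, gam ((n : ℝ) + 1) (y - a) * g a) atTop := by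
  have h1 : ∀ n : ℕ, ∫⁻ a, gam ((n : ℝ) + 1) (y - a) * g a =
      ∫⁻ u, gam 1 u * g (y - (√((n : ℝ) + 1))⁻¹ • u) := fun n =>
    conv_scale (by positivity) g hg.measurable y
  simp_rw [h1]
  refine le_trans ?_ (lintegral_liminf_le fun n => (continuous_gam 1).measurable.mul
    (hg.measurable.comp (by fun_prop)))
  calc g y = ∫⁻ u : κ → ℝ, gam 1 u * g y := by
        rw [lintegral_mul_const _ (continuous_gam 1).measurable, lintegral_gam_one, one_mul]
    _ ≤ _ := by
        refine lintegral_mono fun u => ?_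
        refine le_trans (mul_le_mul' (b := liminf (fun _ : ℕ => gam 1 u) atTop) (by simp)
          (lsc_le_liminf (u := fun n : ℕ => y - (√((n : ℝ) + 1))⁻¹ • u) hg ?_)) ENNReal.le_liminf_mul
        have h2 : Tendsto (fun n : ℕ => (√((n : ℝ) + 1))⁻¹) atTop (𝓝 0) :=
          tendsto_inv_atTop_zero.comp (Real.tendsto_sqrt_atTop.comp
            (tendsto_atTop_add_const_right _ _ tendsto_natCast_atTop_atTop))
        have h3 := (tendsto_const_nhds (x := y)).sub (h2.smul (tendsto_const_nhds (x := u)))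
        simpa using h3

theorem lsc_bound (p : ι → ℝ) (hp : ∀ j, 0 ≤ p j) (L : ∀ j, Matrix (κ j) ν ℝ)
    {D : ℝ} (hD : 0 ≤ D) (hG : GB p L D)
    (g : ∀ j, (κ j → ℝ) → ℝ≥0∞) (hg : ∀ j, LowerSemicontinuous (g j)) (hg0 : ∀ j, 0 < ∫⁻ y, g j y)
    (hg1 : ∀ j, ∫⁻ y, g j y < ⊤) :
    ∫⁻ x : ν → ℝ, ∏ j, (g j (L j *ᵥ x)) ^ p j
    ≤ ENNReal.ofReal (√D) * ∏ j, (∫⁻ y, g j y) ^ p j := by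
  have hpos : ∀ n : ℕ, (0:ℝ) < (n : ℝ) + 1 := fun n => by positivity
  have hb : ∀ n : ℕ, _ := fun n => conv_bound p hp L (inv_pos.2 (hpos n)) (hpos n) hD hG g
    (fun j => (hg j).measurable) hg0 hg1
  have hm : ∀ n : ℕ, Measurable fun x : ν → ℝ => damp ((n : ℝ) + 1)⁻¹ x *
      ∏ j, (∫⁻ a, gam ((n : ℝ) + 1) (L j *ᵥ x - a) * g j a) ^ p j := by
    intro n
    refine (continuous_damp _).measurable.mul (Finset.measurable_fun_prod _ fun j _ => ?_)
    refine Measurable.pow_const ?_ _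
    refine Measurable.lintegral_prod_right' (f := fun z : (ν → ℝ) × (κ j → ℝ) =>
      gam ((n : ℝ) + 1) (L j *ᵥ z.1 - z.2) * g j z.2) ?_
    refine Measurable.mul ?_ ((hg j).measurable.comp measurable_snd)
    exact ((continuous_gam _).comp (g := gam _)
      (f := fun z : (ν → ℝ) × (κ j → ℝ) => L j *ᵥ z.1 - z.2) (by fun_prop)).measurable
  calc _ ≤ ∫⁻ x : ν → ℝ, liminf (fun n : ℕ => damp ((n : ℝ) + 1)⁻¹ x *
      ∏ j, (∫⁻ a, gam ((n : ℝ) + 1) (L j *ᵥ x - a) * g j a) ^ p j) atTop := by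
        refine lintegral_mono fun x => ?_
        have h1 : (1 : ℝ≥0∞) ≤ liminf (fun n : ℕ => damp ((n : ℝ) + 1)⁻¹ x) atTop := by
          have h2 : Tendsto (fun n : ℕ => damp ((n : ℝ) + 1)⁻¹ x) atTop (𝓝 1) := by
            unfold damp
            have h3 : Tendsto (fun n : ℕ => ((n : ℝ) + 1)⁻¹) atTop (𝓝 0) :=
              tendsto_inv_atTop_zero.comp
                (tendsto_atTop_add_const_right _ _ tendsto_natCast_atTop_atTop)
            have h4 : Continuous fun δ : ℝ => ENNReal.ofReal (Real.exp (-Real.pi * δ * ∑ k, x k ^ 2)) :=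
              ENNReal.continuous_ofReal.comp (by fun_prop)
            have h5 := (h4.tendsto 0).comp h3
            simpa [Function.comp_def] using h5
          exact h2.liminf_eq.ge
        refine le_trans (le_of_eq (one_mul _).symm) (le_trans (mul_le_mul' h1
          (prod_rpow_le_liminf hp fun j => conv_liminf (g j) (hg j) (L j *ᵥ x))) ENNReal.le_liminf_mul)
    _ ≤ _ := lintegral_liminf_le hm
    _ ≤ _ := by
        refine (liminf_le_liminf (Eventually.of_forall hb)).trans ?_
        simp

end Conv

section Approx
variable {ι : Type} {κ : ι → Type} [Fintype ι] [∀ j, Fintype (κ j)]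

lemma exists_lsc_seq (p : ι → ℝ) (hp : ∀ j, 0 ≤ p j) (f : ∀ j, (κ j → ℝ) → ℝ≥0∞) (hf : ∀ j, Measurable (f j))
    (hf1 : ∀ j, ∫⁻ y, f j y < ⊤) :
    ∃ g : ℕ → ∀ j, (κ j → ℝ) → ℝ≥0∞, (∀ n j, LowerSemicontinuous (g n j)) ∧ (∀ n j y, f j y ≤ g n j y) ∧
      (∀ n j, ∫⁻ y, g n j y < ⊤) ∧
      Tendsto (fun n => ∏ j, (∫⁻ y, g n j y) ^ p j) atTop (𝓝 (∏ j, (∫⁻ y, f j y) ^ p j)) := by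
  have hε : ∀ n : ℕ, ((n : ℝ≥0∞) + 1)⁻¹ ≠ 0 := fun n => by simp
  choose g hfg hg hgi using fun (n : ℕ) (j : ι) =>
    exists_le_lowerSemicontinuous_lintegral_ge volume (f j) (hf j) (hε n)
  refine ⟨g, hg, hfg, fun n j => (hgi n j).trans_lt ?_, ?_⟩
  · refine ENNReal.add_lt_top.2 ⟨hf1 j, ?_⟩
    rw [ENNReal.inv_lt_top]; positivity
  · refine ENNReal.tendsto_finsetProd_of_ne_top _ (fun j _ => ?_) fun j _ =>
      ENNReal.rpow_ne_top_of_nonneg (hp j) (hf1 j).ne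
    refine Tendsto.ennrpow_const _ ?_
    refine tendsto_of_tendsto_of_tendsto_of_le_of_le (tendsto_const_nhds)
      (h := fun n : ℕ => (∫⁻ y, f j y) + ((n : ℝ≥0∞) + 1)⁻¹) ?_ (fun n => lintegral_mono (hfg n j)) (fun n => hgi n j)
    have h0 : Tendsto (fun n : ℕ => ((n : ℝ≥0∞) + 1)⁻¹) atTop (𝓝 0) := by
      have := (tendsto_add_atTop_iff_nat 1).2 ENNReal.tendsto_inv_nat_nhds_zero
      simpa using this
    simpa using (tendsto_const_nhds (x := ∫⁻ y, f j y)).add h0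

end Approx
end BLC

namespace BLC
open Matrix Filter Topology

section Final
variable {ι ν : Type} {κ : ι → Type} [Fintype ι] [DecidableEq ι] [Fintype ν] [DecidableEq ν]
  [∀ j, Fintype (κ j)] [∀ j, DecidableEq (κ j)]

theorem full_bound (p : ι → ℝ) (hp : ∀ j, 0 ≤ p j) (L : ∀ j, Matrix (κ j) ν ℝ)
    {D : ℝ} (hD : 0 ≤ D) (hG : GB p L D)
    (f : ∀ j, (κ j → ℝ) → ℝ≥0∞) (hf : ∀ j, Measurable (f j)) (hf0 : ∀ j, 0 < ∫⁻ y, f j y)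
    (hf1 : ∀ j, ∫⁻ y, f j y < ⊤) :
    ∫⁻ x : ν → ℝ, ∏ j, (f j (L j *ᵥ x)) ^ p j
    ≤ ENNReal.ofReal (√D) * ∏ j, (∫⁻ y, f j y) ^ p j := by
  obtain ⟨g, hg, hfg, hg1, hlim⟩ := exists_lsc_seq p hp f hf hf1
  refine ge_of_tendsto' (ENNReal.Tendsto.const_mul hlim (Or.inr ENNReal.ofReal_ne_top)) fun n => ?_
  refine le_trans (lintegral_mono fun x => Finset.prod_le_prod' fun j _ =>
    ENNReal.rpow_le_rpow (hfg n j _) (hp j)) (lsc_bound p hp L hD hG (g n) (hg n)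
      (fun j => (hf0 j).trans_le (lintegral_mono (hfg n j))) (hg1 n))

end Final

section Main
variable {m n : ℕ} {ni : Fin m → ℕ}

lemma prod_pos_top (p : Fin m → ℝ) (hp : ∀ j, 0 ≤ p j) (c : Fin m → ℝ≥0∞) (h0 : ∀ j, 0 < c j) (h1 : ∀ j, c j < ⊤) :
    ∏ j, c j ^ p j ≠ 0 ∧ ∏ j, c j ^ p j ≠ ⊤ := by
  constructor
  · rw [Finset.prod_ne_zero_iff]
    exact fun j _ => (ENNReal.rpow_pos (h0 j) (h1 j).ne).ne'
  · exact ENNReal.prod_ne_top fun j _ => ENNReal.rpow_ne_top_of_nonneg (hp j) (h1 j).ne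

lemma le_bl (L : ∀ j, (Fin n → ℝ) →L[ℝ] (Fin (ni j) → ℝ)) (p : Fin m → ℝ)
    (f : ∀ j, (Fin (ni j) → ℝ) → ℝ≥0∞) (hf : ∀ j, Measurable (f j)) (hf0 : ∀ j, 0 < ∫⁻ y, f j y)
    (hf1 : ∀ j, ∫⁻ y, f j y < ⊤) :
    (∫⁻ x : Fin n → ℝ, ∏ j, (f j (L j x)) ^ (p j)) / ∏ j, (∫⁻ y, f j y) ^ (p j) ≤ brascampLieb L p := by
  unfold brascampLieb
  exact le_iSup_of_le f (le_iSup_of_le hf (le_iSup_of_le hf0 (le_iSup_of_le hf1 le_rfl)))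

lemma bl_lower (p : Fin m → ℝ) (hp : ∀ j, 0 ≤ p j) (L0 : ∀ j, (Fin n → ℝ) →L[ℝ] (Fin (ni j) → ℝ))
    (b : ℝ≥0∞) (hb : b < brascampLieb L0 p) : ∀ᶠ L in 𝓝 L0, b < brascampLieb L p := by
  unfold brascampLieb at hb
  simp only [lt_iSup_iff] at hb
  obtain ⟨f, hf, hf0, hf1, hb⟩ := hb
  obtain ⟨g, hg, hfg, hg1, hlim⟩ := exists_lsc_seq p hp f hf hf1
  obtain ⟨hP0, hP1⟩ := prod_pos_top p hp _ hf0 hf1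
  have h1 := ENNReal.Tendsto.const_div (a := ∫⁻ x : Fin n → ℝ, ∏ j, (f j (L0 j x)) ^ (p j)) hlim
    (Or.inl hP1)
  obtain ⟨k, hk⟩ := (h1.eventually (lt_mem_nhds hb)).exists
  have hg0 : ∀ j, 0 < ∫⁻ y, g k j y := fun j => (hf0 j).trans_le (lintegral_mono (hfg k j))
  obtain ⟨hQ0, hQ1⟩ := prod_pos_top p hp _ hg0 (hg1 k)
  set Q := ∏ j, (∫⁻ y, g k j y) ^ p j with hQ
  have h2 : b * Q < ∫⁻ x : Fin n → ℝ, ∏ j, (g k j (L0 j x)) ^ (p j) := by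
    refine lt_of_lt_of_le ((ENNReal.lt_div_iff_mul_lt (Or.inl hQ0) (Or.inl hQ1)).1 hk) ?_
    exact lintegral_mono fun x => Finset.prod_le_prod' fun j _ => ENNReal.rpow_le_rpow (hfg k j _) (hp j)
  have h3 : ∫⁻ x : Fin n → ℝ, ∏ j, (g k j (L0 j x)) ^ (p j) ≤
      liminf (fun L : ∀ j, (Fin n → ℝ) →L[ℝ] (Fin (ni j) → ℝ) =>
        ∫⁻ x : Fin n → ℝ, ∏ j, (g k j (L j x)) ^ (p j)) (𝓝 L0) := by
    refine le_trans (lintegral_mono fun x => ?_) (lintegral_liminf_le fun L => ?_)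
    · refine prod_rpow_le_liminf hp fun j => lsc_le_liminf (hg k j) ?_
      have : Continuous fun L : ∀ j, (Fin n → ℝ) →L[ℝ] (Fin (ni j) → ℝ) => L j x := by fun_prop
      exact this.tendsto L0
    · refine Finset.measurable_fun_prod _ fun j _ => Measurable.pow_const ?_ _
      exact (hg k j).measurable.comp (L j).continuous.measurable
  filter_upwards [eventually_lt_of_lt_liminf (h2.trans_le h3)] with L hL
  refine lt_of_lt_of_le ?_ (le_bl L p (g k) (fun j => (hg k j).measurable) hg0 (hg1 k))
  exact (ENNReal.lt_div_iff_mul_lt (Or.inl hQ0) (Or.inl hQ1)).2 hL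

lemma bl_upper (p : Fin m → ℝ) (hp : ∀ j, 0 ≤ p j) (L0 : ∀ j, (Fin n → ℝ) →L[ℝ] (Fin (ni j) → ℝ))
    (b : ℝ≥0∞) (hb : brascampLieb L0 p < b) : ∀ᶠ L in 𝓝 L0, brascampLieb L p < b := by
  have htop : brascampLieb L0 p ≠ ⊤ := (hb.trans_le le_top).ne
  set C := (brascampLieb L0 p).toReal with hC
  have hC0 : 0 ≤ C := ENNReal.toReal_nonneg
  have hCe : ENNReal.ofReal C = brascampLieb L0 p := ENNReal.ofReal_toReal htop
  let T : (∀ j, (Fin n → ℝ) →L[ℝ] (Fin (ni j) → ℝ)) → ∀ j, Matrix (Fin (ni j)) (Fin n) ℝ :=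
    fun L j => LinearMap.toMatrix' (L j : (Fin n → ℝ) →ₗ[ℝ] (Fin (ni j) → ℝ))
  have hT : ∀ L j x, T L j *ᵥ x = L j x := fun L j x => LinearMap.toMatrix'_mulVec _ _
  have hTc : Continuous T := by
    refine continuous_pi fun j => continuous_matrix fun i k => ?_
    simp only [T, LinearMap.toMatrix'_apply]
    have : Continuous fun L : ∀ j, (Fin n → ℝ) →L[ℝ] (Fin (ni j) → ℝ) => L j (Pi.single k 1) i := by fun_prop
    exact this
  have hG : GB p (T L0) (C ^ 2) := by
    refine GB_of_bound p hp (T L0) C hC0 fun f hf hf0 hf1 => ?_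
    obtain ⟨hP0, hP1⟩ := prod_pos_top p hp _ hf0 hf1
    simp_rw [hT]
    rw [hCe]
    exact (ENNReal.div_le_iff hP0 hP1).1 (le_bl L0 p f hf hf0 hf1)
  obtain ⟨ε, hε, hε1, hεb⟩ : ∃ ε : ℝ, 0 < ε ∧ ε < 1 ∧ ENNReal.ofReal (√(C ^ 2 / (1 - ε))) < b := by
    have h1 : ContinuousAt (fun ε : ℝ => ENNReal.ofReal (√(C ^ 2 / (1 - ε)))) 0 := by
      refine ENNReal.continuous_ofReal.continuousAt.comp (Real.continuous_sqrt.continuousAt.comp ?_)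
      exact ContinuousAt.div (by fun_prop) (by fun_prop) (by norm_num)
    have h2 : ENNReal.ofReal (√(C ^ 2 / (1 - 0))) < b := by
      rw [sub_zero, div_one, Real.sqrt_sq hC0, hCe]; exact hb
    have h3 := (h1.eventually (gt_mem_nhds h2)).and (gt_mem_nhds (zero_lt_one (α := ℝ)))
    have h4 := (h3.filter_mono (nhdsWithin_le_nhds (s := Set.Ioi 0))).and self_mem_nhdsWithin
    obtain ⟨ε, ⟨ha, hb⟩, hc⟩ := h4.exists
    exact ⟨ε, hc, hb, ha⟩
  have hev := hTc.continuousAt.eventually (GB_usc p hp (T L0) (C ^ 2) (sq_nonneg _) hG ε hε hε1)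
  filter_upwards [hev] with L hL
  refine lt_of_le_of_lt ?_ hεb
  unfold brascampLieb
  refine iSup_le fun f => iSup_le fun hf => iSup_le fun hf0 => iSup_le fun hf1 => ?_
  obtain ⟨hP0, hP1⟩ := prod_pos_top p hp _ hf0 hf1
  rw [ENNReal.div_le_iff hP0 hP1]
  have := full_bound p hp (T L) (div_nonneg (sq_nonneg _) (by linarith)) hL f hf hf0 hf1
  simp_rw [hT] at this
  exact this

end Main
end BLC

/-- **Continuity of the Brascamp–Lieb constant.** For fixed exponents `p` with
`p j ∈ [0,1]` and dimensions `n_j ≤ n`, the map `L ↦ BL(L, p)` is continuous on the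
set of tuples of surjective linear maps, with values in `[0,∞]`. -/
theorem brascampLieb_continuousOn {m n : ℕ} {ni : Fin m → ℕ}
    (hni : ∀ j, ni j ≤ n) (p : Fin m → ℝ) (hp : ∀ j, p j ∈ Set.Icc (0:ℝ) 1) :
    ContinuousOn (fun L : ∀ j, (Fin n → ℝ) →L[ℝ] (Fin (ni j) → ℝ) => brascampLieb L p)
      {L | ∀ j, Function.Surjective (L j)} := by
  refine Continuous.continuousOn (continuous_iff_continuousAt.2 fun L0 => ?_)
  exact tendsto_order.2 ⟨fun b hb => BLC.bl_lower p (fun j => (hp j).1) L0 b hb,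
    fun b hb => BLC.bl_upper p (fun j => (hp j).1) L0 b hb⟩
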